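/- arXiv:2202.08653 — 2 statements merged into one kernel-verified Lean document; each statement's English description precedes it below -/
import Mathlib

section
/- Let X be a separable Banach space, κ : X → (0,∞) bounded continuous with c_κ := sup_{x∈X} sup_{‖y‖≤1} κ(x)/κ(x−y) < ∞, and (μ_n) Borel probability measures on X with μ_n({y : ‖y‖ > 1/n}) = 0. Let (S(t))_{t≥0} satisfy Assumption S. Let f ∈ L^S_+ be such that f_n := f*μ_n ∈ D(A_Γ) for all n, and assume that for every ε > 0 there exist δ, t₀ > 0 with ‖S(t)(τ_x f) − τ_x(S(t)f)‖_κ ≤ ε·t for all t ∈ [0,t₀] and all x ∈ X with ‖x‖ ≤ δ, where (τ_x g)(y) := g(x+y). Then f ∈ D(A_Γ) and A_Γf = Γ-lim_{n→∞} A_Γf_n. -/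
open Filter MeasureTheory Topology
open scoped ENNReal Topology

noncomputable section

def ecoe {X : Type*} (f : X → ℝ) : X → EReal := fun x => (f x : EReal)

variable {X : Type*} [MetricSpace X]

/-- membership in `C_κ` -/
def MemCk (κ : X → ℝ) (f : X → ℝ) : Prop :=
  Continuous f ∧ ∃ r : ℝ, ∀ x, |f x| * κ x ≤ r

/-- `‖f‖_κ ≤ r` -/
def CkBound (κ : X → ℝ) (r : ℝ) (f : X → ℝ) : Prop := ∀ x, |f x| * κ x ≤ r

/-- extended `κ`-norm of an `EReal`-valued function -/
def eknorm (κ : X → ℝ) (f : X → EReal) : ℝ≥0∞ :=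
  ⨆ x, (f x).abs * ENNReal.ofReal (κ x)

/-- positive part of an `EReal`-valued function -/
def epos {X : Type*} (f : X → EReal) : X → EReal := fun x => max (f x) 0

/-- membership in `U_κ` -/
def MemUk (κ : X → ℝ) (f : X → EReal) : Prop :=
  UpperSemicontinuous f ∧ (∀ x, f x < ⊤) ∧
    ∃ r : ℝ, ∀ x, max (f x) 0 * (κ x : EReal) ≤ (r : EReal)

/-- `Γ`-limsup of a sequence of functions -/
def gammaLimsup (f : ℕ → X → EReal) (x : X) : EReal :=
  ⨆ (u : ℕ → X) (_ : Tendsto u atTop (𝓝 x)),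
    Filter.limsup (fun n => f n (u n)) atTop

/-- `g = Γ-lim f_n` -/
def IsGammaLim (f : ℕ → X → EReal) (g : X → EReal) : Prop :=
  ∀ x : X,
    (∀ u : ℕ → X, Tendsto u atTop (𝓝 x) →
      Filter.limsup (fun n => f n (u n)) atTop ≤ g x) ∧
    (∃ u : ℕ → X, Tendsto u atTop (𝓝 x) ∧
      Tendsto (fun n => f n (u n)) atTop (𝓝 (g x)))

/-- `Γ`-limsup as `h ↓ 0` -/
def gammaLimsupZero (F : ℝ → X → EReal) (x : X) : EReal :=
  ⨆ (h : ℕ → ℝ) (_ : ∀ n, 0 < h n) (_ : Tendsto h atTop (𝓝 (0:ℝ))),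
    gammaLimsup (fun n => F (h n)) x

/-- `Γ`-limsup as `s → t`, `s ≥ 0` -/
def gammaLimsupAt (F : ℝ → X → EReal) (t : ℝ) (x : X) : EReal :=
  ⨆ (s : ℕ → ℝ) (_ : ∀ n, 0 ≤ s n) (_ : Tendsto s atTop (𝓝 t)),
    gammaLimsup (fun n => F (s n)) x

/-- Assumption S on a family of operators on `U_κ` -/
structure AssumptionS (κ : X → ℝ) (S : ℝ → (X → EReal) → (X → EReal)) : Prop where
  monotone : ∀ t, 0 ≤ t → ∀ f g, MemUk κ f → MemUk κ g →
    (∀ x, f x ≤ g x) → ∀ x, S t f x ≤ S t g x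
  convex : ∀ t, 0 ≤ t → ∀ f g, MemUk κ f → MemUk κ g → ∀ lam : ℝ, 0 ≤ lam → lam ≤ 1 →
    ∀ x, S t (fun y => (lam : EReal) * f y + ((1 - lam : ℝ) : EReal) * g y) x
      ≤ (lam : EReal) * S t f x + ((1 - lam : ℝ) : EReal) * S t g x
  zero : ∀ t, 0 ≤ t → ∀ x, S t (fun _ => (0 : EReal)) x = 0
  maps : ∀ t, 0 ≤ t → ∀ f, MemUk κ f → MemUk κ (S t f)
  contAbove : ∀ t, 0 ≤ t → ∀ (f : ℕ → X → EReal) (g : X → EReal),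
    (∀ n, MemUk κ (f n)) → MemUk κ g →
    (∀ x, Antitone fun n => f n x) → (∀ x, (⨅ n, f n x) = g x) →
    ∀ x, (⨅ n, S t (f n) x) = S t g x
  gammaUsc : ∀ t, 0 ≤ t → ∀ f, MemUk κ f →
    ∀ x, gammaLimsupAt (fun s => S s f) t x ≤ S t f x
  idZero : ∀ f, MemUk κ f → S 0 f = f
  bounded : ∀ r t : ℝ, 0 ≤ r → 0 ≤ t → ∃ C : ℝ≥0∞, C ≠ ⊤ ∧
    ∀ s, 0 ≤ s → s ≤ t → ∀ f : X → ℝ, MemCk κ f → CkBound κ r f →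
      eknorm κ (S s (ecoe f)) ≤ C

/-- an `EReal`-valued function which belongs to `C_κ` -/
def IsCk (κ : X → ℝ) (F : X → EReal) : Prop :=
  ∃ g : X → ℝ, MemCk κ g ∧ ∀ x, F x = (g x : EReal)

/-- the upper Lipschitz set `L^S_+` -/
def UpperLip (κ : X → ℝ) (S : ℝ → (X → EReal) → (X → EReal)) (f : X → ℝ) : Prop :=
  MemCk κ f ∧
  (∀ t, 0 ≤ t → IsCk κ (S t (ecoe f))) ∧
  (∀ s t, 0 ≤ s → 0 ≤ t → S (s + t) (ecoe f) = S s (S t (ecoe f))) ∧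
  ∃ h₀ > (0:ℝ), ∃ c ≥ (0:ℝ), ∀ h, 0 ≤ h → h ≤ h₀ → ∀ x,
    max (S h (ecoe f) x - (f x : EReal)) 0 * (κ x : EReal) ≤ ((c * h : ℝ) : EReal)

/-- the (two-sided) Lipschitz set `L^S` -/
def LipSet (κ : X → ℝ) (S : ℝ → (X → EReal) → (X → EReal)) (f : X → ℝ) : Prop :=
  MemCk κ f ∧
  (∀ t, 0 ≤ t → IsCk κ (S t (ecoe f))) ∧
  (∀ s t, 0 ≤ s → 0 ≤ t → S (s + t) (ecoe f) = S s (S t (ecoe f))) ∧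
  ∃ h₀ > (0:ℝ), ∃ c ≥ (0:ℝ), ∀ h, 0 ≤ h → h ≤ h₀ → ∀ x,
    (S h (ecoe f) x - (f x : EReal)).abs * ENNReal.ofReal (κ x) ≤ ENNReal.ofReal (c * h)

/-- difference quotient `(S(h)f - f)/h` -/
def diffQuot (S : ℝ → (X → EReal) → (X → EReal)) (f : X → ℝ) (h : ℝ) : X → EReal :=
  fun x => ((h⁻¹ : ℝ) : EReal) * (S h (ecoe f) x - (f x : EReal))

/-- the upper `Γ`-generator `A_Γ⁺` -/
def uppGen (S : ℝ → (X → EReal) → (X → EReal)) (f : X → ℝ) : X → EReal :=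
  fun x => gammaLimsupZero (fun h => diffQuot S f h) x

/-- `g = A_Γ f`, i.e. the `Γ`-limit of the difference quotients exists and equals `g` -/
def IsGammaDeriv (S : ℝ → (X → EReal) → (X → EReal)) (f : X → ℝ) (g : X → EReal) : Prop :=
  ∀ h : ℕ → ℝ, (∀ n, 0 < h n) → Tendsto h atTop (𝓝 (0:ℝ)) →
    IsGammaLim (fun n => diffQuot S f (h n)) g

/-- `g = Af` in the mixed topology -/
def MixedDeriv (κ : X → ℝ) (S : ℝ → (X → EReal) → (X → EReal)) (f : X → ℝ) (g : X → ℝ) : Prop :=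
  (∃ h₀ > (0:ℝ), ∃ r : ℝ, ∀ h, 0 < h → h ≤ h₀ → ∀ x,
      |h⁻¹ * ((S h (ecoe f) x).toReal - f x)| * κ x ≤ r) ∧
  ∀ K : Set X, IsCompact K → ∀ ε > (0:ℝ), ∃ h₀ > (0:ℝ), ∀ h, 0 < h → h ≤ h₀ → ∀ x ∈ K,
    |h⁻¹ * ((S h (ecoe f) x).toReal - f x) - g x| ≤ ε

/-- upper `ε`-parallel function -/
def parallel (κ : X → ℝ) (f : X → EReal) (ε : ℝ) : X → EReal :=
  fun x => (((κ x)⁻¹ : ℝ) : EReal) *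
    ((⨆ y ∈ Metric.closedBall x ε, max (f y * (κ y : EReal)) (((-ε⁻¹ : ℝ)) : EReal)) + (ε : EReal))

/-- upper semicontinuous envelope of the upper `ε`-parallel function -/
def parallelEnv (κ : X → ℝ) (f : X → EReal) (ε : ℝ) : X → EReal :=
  fun x => ⨅ (δ : ℝ) (_ : 0 < δ), ⨆ y ∈ Metric.closedBall x δ, parallel κ f ε y

end

noncomputable section

/-- truncation of an extended real to `ℝ≥0∞` -/
def erealToENNReal (x : EReal) : ℝ≥0∞ := if x = ⊤ then ⊤ else ENNReal.ofReal x.toReal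

/-- Lebesgue integral of an `EReal`-valued function on `(a,b]`, with values in `[-∞,∞]` -/
def eIntegral (a b : ℝ) (F : ℝ → EReal) : EReal :=
  ((∫⁻ s in Set.Ioc a b, erealToENNReal (max (F s) 0)) : ℝ≥0∞) -
  ((∫⁻ s in Set.Ioc a b, erealToENNReal (max (-F s) 0)) : ℝ≥0∞)

/-- convolution `f * μ` of an `EReal`-valued function with a measure -/
def econv {X : Type*} [NormedAddCommGroup X] [MeasurableSpace X]
    (μ : Measure X) (f : X → EReal) (x : X) : EReal :=
  ((∫⁻ y, erealToENNReal (max (f (x - y)) 0) ∂μ : ℝ≥0∞) : EReal) -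
  ((∫⁻ y, erealToENNReal (max (-f (x - y)) 0) ∂μ : ℝ≥0∞) : EReal)

/-- conjugate functional `φ*` -/
def dualConj {X : Type*} [MetricSpace X] [MeasurableSpace X]
    (κ : X → ℝ) (φ : (X → ℝ) → ℝ) (μ : Measure X) : EReal :=
  ⨆ f : {g : X → ℝ // MemCk κ g}, (((∫ x, f.1 x ∂μ) : ℝ) : EReal) - ((φ f.1 : ℝ) : EReal)

/-- the topology `σ(ca_κ⁺, C_κ)` on measures -/
def weakTopo {X : Type*} [MetricSpace X] [MeasurableSpace X] (κ : X → ℝ) :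
    TopologicalSpace (Measure X) :=
  TopologicalSpace.induced
    (fun μ => fun f : {g : X → ℝ // MemCk κ g} => ∫ x, f.1 x ∂μ) Pi.topologicalSpace

/-- `φ₁`, the extension of `φ` from `C_κ` to `U_κ` -/
def extUk {X : Type*} [MetricSpace X] (κ : X → ℝ) (φ : (X → ℝ) → ℝ) (f : X → EReal) : EReal :=
  ⨅ g : {g : X → ℝ // MemCk κ g ∧ ∀ x, f x ≤ (g x : EReal)}, ((φ g.1 : ℝ) : EReal)

end


section helper1

variable {X : Type*} [MetricSpace X]

/-- usc envelope of the tail supremum -/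
noncomputable def env (F : ℕ → X → EReal) (k : ℕ) (x : X) : EReal :=
  limsup (fun y => ⨆ j, ⨆ (_ : k ≤ j), F j y) (𝓝 x)

lemma le_env (F : ℕ → X → EReal) {k j : ℕ} (h : k ≤ j) (x : X) : F j x ≤ env F k x := by
  unfold env
  refine le_trans (le_iSup₂ (f := fun j (_ : k ≤ j) => F j x) j h) ?_
  refine le_limsup_of_frequently_le (f := 𝓝 x) ?_
  rw [Filter.Frequently]
  intro hn
  have := hn.self_of_nhds
  exact this le_rfl

lemma env_antitone (F : ℕ → X → EReal) (x : X) : Antitone fun k => env F k x := by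
  intro a b hab
  refine limsup_le_limsup (Eventually.of_forall fun y => ?_)
  exact iSup_mono fun j => iSup_mono' fun hj => ⟨hab.trans hj, le_rfl⟩

lemma env_usc (F : ℕ → X → EReal) (k : ℕ) : UpperSemicontinuous (env F k) := by
  intro x b hb
  obtain ⟨c, hc1, hc2⟩ := exists_between hb
  have h := eventually_lt_of_limsup_lt hc1
  filter_upwards [eventually_eventually_nhds.2 h] with y hy
  refine lt_of_le_of_lt ?_ hc2
  exact limsup_le_of_le (h := hy.mono fun z hz => hz.le)

lemma env_le (F : ℕ → X → EReal) (k : ℕ) (G : X → EReal) (hG : Continuous G)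
    (h : ∀ j, k ≤ j → ∀ y, F j y ≤ G y) (x : X) : env F k x ≤ G x := by
  refine le_of_forall_gt fun b hb => ?_
  obtain ⟨c, hc1, hc2⟩ := exists_between hb
  refine lt_of_le_of_lt ?_ hc2
  have : ∀ᶠ y in 𝓝 x, G y < c := hG.continuousAt.eventually_lt continuousAt_const hc1
  refine limsup_le_of_le (h := this.mono fun y hy => ?_)
  exact iSup₂_le fun j hj => (h j hj y).trans hy.le

lemma env_le_of_eventually (F : ℕ → X → EReal) (x : X) (b : EReal)
    (h : ∀ᶠ p in (atTop : Filter ℕ) ×ˢ 𝓝 x, F p.1 p.2 ≤ b) :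
    ∃ K, ∀ k, K ≤ k → env F k x ≤ b := by
  obtain ⟨pa, ha, pb, hb, hab⟩ := eventually_prod_iff.1 h
  obtain ⟨K, hK⟩ := eventually_atTop.1 ha
  refine ⟨K, fun k hk => limsup_le_of_le (h := hb.mono fun y hy => ?_)⟩
  exact iSup₂_le fun j hj => hab (hK j (hk.trans hj)) hy

lemma eventually_of_seq (F : ℕ → X → EReal) (x : X) (c : EReal)
    (h : ∀ u : ℕ → X, Tendsto u atTop (𝓝 x) → limsup (fun n => F n (u n)) atTop ≤ c)
    (b : EReal) (hb : c < b) :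
    ∀ᶠ p in (atTop : Filter ℕ) ×ˢ 𝓝 x, F p.1 p.2 < b := by
  by_contra hcon
  have hfr : ∃ᶠ p in (atTop : Filter ℕ) ×ˢ 𝓝 x, b ≤ F p.1 p.2 := by
    intro hh
    exact hcon (hh.mono fun p hp => not_le.1 hp)
  obtain ⟨p, hp, hpb⟩ := exists_seq_forall_of_frequently hfr
  have hp1 : Tendsto (fun n => (p n).1) atTop atTop := tendsto_fst.comp hp
  have hp2 : Tendsto (fun n => (p n).2) atTop (𝓝 x) := tendsto_snd.comp hp
  obtain ⟨φ, hφ, hφ2⟩ := strictMono_subseq_of_tendsto_atTop hp1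
  classical
  set ψ : ℕ → ℕ := fun n => (p (φ n)).1 with hψ
  have hψm : StrictMono ψ := hφ2
  let u : ℕ → X := Function.extend ψ (fun n => (p (φ n)).2) (fun _ => x)
  have hu1 : ∀ n, u (ψ n) = (p (φ n)).2 := fun n => hψm.injective.extend_apply _ _ n
  have hu : Tendsto u atTop (𝓝 x) := by
    intro U hU
    have h1 : ∀ᶠ n in atTop, (p (φ n)).2 ∈ U := (hp2.comp hφ.tendsto_atTop) hU
    obtain ⟨N, hN⟩ := eventually_atTop.1 h1
    refine mem_map.2 (mem_atTop_sets.2 ⟨ψ N, fun m hm => ?_⟩)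
    by_cases hex : ∃ n, ψ n = m
    · obtain ⟨n, rfl⟩ := hex
      change u (ψ n) ∈ U
      rw [hu1]
      exact hN n (hψm.le_iff_le.1 hm)
    · change u m ∈ U
      have : u m = x := Function.extend_apply' _ _ _ hex
      rw [this]; exact mem_of_mem_nhds hU
  have h2 := h u hu
  have h3 : b ≤ limsup (fun n => F n (u n)) atTop := by
    refine le_limsup_of_frequently_le ?_
    refine frequently_atTop.2 fun N => ⟨ψ N, hψm.id_le N, ?_⟩
    rw [hu1]; exact hpb _
  exact absurd (h3.trans h2) (not_le.2 hb)

lemma eventually_prod_of_seq (F : ℝ → X → EReal) (x : X) (b : EReal)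
    (h : gammaLimsupAt F 0 x < b) :
    ∃ δ > (0:ℝ), ∀ s, 0 ≤ s → s < δ → ∀ z, dist z x < δ → F s z < b := by
  by_contra hcon
  push Not at hcon
  choose s hs0 hs z hz hF using fun n : ℕ => hcon (1 / ((n:ℝ) + 1)) (by positivity)
  have hs' : Tendsto s atTop (𝓝 0) :=
    squeeze_zero hs0 (fun n => (hs n).le) tendsto_one_div_add_atTop_nhds_zero_nat
  have hz' : Tendsto z atTop (𝓝 x) := by
    rw [tendsto_iff_dist_tendsto_zero]
    exact squeeze_zero (fun _ => dist_nonneg) (fun n => (hz n).le)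
      tendsto_one_div_add_atTop_nhds_zero_nat
  have h1 : b ≤ limsup (fun n => F (s n) (z n)) atTop :=
    le_limsup_of_frequently_le (Eventually.frequently (Eventually.of_forall hF))
  have h2 : limsup (fun n => F (s n) (z n)) atTop ≤ gammaLimsupAt F 0 x := by
    unfold gammaLimsupAt
    refine le_trans ?_ (le_iSup_of_le s (le_iSup₂_of_le hs0 hs' le_rfl))
    unfold gammaLimsup
    exact le_iSup₂_of_le z hz' le_rfl
  exact absurd (h1.trans h2) (not_le.2 h)

/-- criterion for Gamma convergence at a point -/
lemma gamma_crit (F : ℕ → X → EReal) (x : X) (c : EReal)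
    (h1 : ∀ a : ℝ, c < a → ∀ᶠ p in (atTop : Filter ℕ) ×ˢ 𝓝 x, F p.1 p.2 ≤ a)
    (h2 : ∀ b : ℝ, (b : EReal) < c → ∀ U ∈ 𝓝 x, ∀ᶠ n in atTop, ∃ y ∈ U, (b : EReal) < F n y) :
    (∀ u : ℕ → X, Tendsto u atTop (𝓝 x) → limsup (fun n => F n (u n)) atTop ≤ c) ∧
    (∃ u : ℕ → X, Tendsto u atTop (𝓝 x) ∧ Tendsto (fun n => F n (u n)) atTop (𝓝 c)) := by
  have key : ∀ u : ℕ → X, Tendsto u atTop (𝓝 x) → ∀ a : EReal, c < a →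
      ∀ᶠ n in atTop, F n (u n) < a := by
    intro u hu a ha
    obtain ⟨r, hr1, hr2⟩ := EReal.lt_iff_exists_real_btwn.1 ha
    have : Tendsto (fun n => (n, u n)) atTop ((atTop : Filter ℕ) ×ˢ 𝓝 x) :=
      tendsto_id.prodMk hu
    exact (this.eventually (h1 r hr1)).mono fun n hn => lt_of_le_of_lt hn hr2
  refine ⟨fun u hu => ?_, ?_⟩
  · refine le_of_forall_gt_imp_ge_of_dense fun a ha => ?_
    exact limsup_le_of_le (h := (key u hu a ha).mono fun n hn => hn.le)
  · by_cases hc : c = ⊥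
    · refine ⟨fun _ => x, tendsto_const_nhds, ?_⟩
      rw [hc, tendsto_order]
      refine ⟨fun a ha => absurd ha not_lt_bot, fun a ha => ?_⟩
      exact key _ tendsto_const_nhds a (hc ▸ ha)
    have hbot : (⊥ : EReal) < c := bot_lt_iff_ne_bot.2 hc
    obtain ⟨b, hbm, hbI, hbt⟩ := exists_seq_strictMono_tendsto' hbot
    classical
    let P : ℕ → ℕ → Prop := fun m n => ∃ y ∈ Metric.ball x (1 / ((m:ℝ) + 1)), b m < F n y
    have hP : ∀ m, ∀ᶠ n in atTop, P m n := by
      intro m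
      obtain ⟨r, hr1, hr2⟩ := EReal.lt_iff_exists_real_btwn.1 (hbI m).2
      refine (h2 r hr2 (Metric.ball x (1 / ((m:ℝ) + 1)))
        (Metric.ball_mem_nhds x Nat.one_div_pos_of_nat)).mono ?_
      rintro n ⟨y, hy, hy2⟩
      exact ⟨y, hy, hr1.trans hy2⟩
    let m : ℕ → ℕ := fun n => Nat.findGreatest (fun m => P m n) n
    have hm : Tendsto m atTop atTop := by
      refine tendsto_atTop.2 fun M => ?_
      filter_upwards [hP M, eventually_ge_atTop M] with n hn hnM
      exact Nat.le_findGreatest hnM hn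
    have hPm : ∀ᶠ n in atTop, P (m n) n := by
      filter_upwards [hP 0] with n hn
      exact Nat.findGreatest_spec (P := fun m => P m n) (Nat.zero_le n) hn
    let u : ℕ → X := fun n => if h : P (m n) n then h.choose else x
    have hu1 : ∀ n, dist (u n) x ≤ 1 / ((m n : ℝ) + 1) := by
      intro n
      by_cases h : P (m n) n
      · simp only [u, h, dif_pos]
        exact (Metric.mem_ball.1 h.choose_spec.1).le
      · simp only [u, h, dif_neg, not_false_eq_true, dist_self]
        positivity
    have hu : Tendsto u atTop (𝓝 x) := by
      rw [tendsto_iff_dist_tendsto_zero]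
      exact squeeze_zero (fun _ => dist_nonneg) hu1
        ((tendsto_one_div_add_atTop_nhds_zero_nat (𝕜 := ℝ)).comp hm)
    refine ⟨u, hu, ?_⟩
    rw [tendsto_order]
    refine ⟨fun a ha => ?_, fun a ha => key u hu a ha⟩
    filter_upwards [hPm, (hbt.comp hm).eventually (lt_mem_nhds ha)] with n hn hn2
    have : u n = hn.choose := by simp only [u, hn, dif_pos]
    rw [this]
    exact lt_trans hn2 hn.choose_spec.2

/-- Dini type lemma -/
lemma dini_le (φ : ℝ → ℝ) (t a C η₀ : ℝ) (ht : 0 ≤ t) (hη : 0 < η₀) (hC : 0 ≤ C)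
    (h1 : ∀ s, 0 ≤ s → s < t → ∀ η > (0:ℝ), ∃ h, 0 < h ∧ h < η ∧ φ (s + h) ≤ φ s + a * h)
    (h2 : ∀ r h, 0 ≤ r → 0 ≤ h → r + h ≤ t → h ≤ η₀ → φ (r + h) ≤ φ r + C * h) :
    φ t ≤ φ 0 + a * t := by
  let A : Set ℝ := {s | 0 ≤ s ∧ s ≤ t ∧ φ s ≤ φ 0 + a * s}
  have h0 : (0:ℝ) ∈ A := ⟨le_rfl, ht, by simp⟩
  have hbd : BddAbove A := ⟨t, fun s hs => hs.2.1⟩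
  set m := sSup A with hm
  have hm0 : 0 ≤ m := le_csSup hbd h0
  have hmt : m ≤ t := csSup_le ⟨0, h0⟩ fun s hs => hs.2.1
  have hmA : φ m ≤ φ 0 + a * m := by
    refine le_of_forall_pos_le_add fun ε hε => ?_
    set ρ := min η₀ (ε / (C + |a| + 1)) with hρ
    have hpos : 0 < C + |a| + 1 := by linarith [abs_nonneg a]
    have hρ0 : 0 < ρ := lt_min hη (div_pos hε hpos)
    obtain ⟨s, hs, hs2⟩ := exists_lt_of_lt_csSup ⟨0, h0⟩ (show m - ρ < sSup A by linarith)
    have hsm : s ≤ m := le_csSup hbd hs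
    have h3 := h2 s (m - s) hs.1 (by linarith) (by linarith)
      (by have := min_le_left η₀ (ε / (C + |a| + 1)); linarith)
    have h4 : m - s ≤ ε / (C + |a| + 1) := by
      have := min_le_right η₀ (ε / (C + |a| + 1)); linarith
    rw [le_div_iff₀ hpos] at h4
    rw [add_sub_cancel] at h3
    have h5 := hs.2.2
    have h6 : -|a| ≤ a := neg_abs_le a
    nlinarith [mul_nonneg (sub_nonneg.2 hsm) (by linarith : (0:ℝ) ≤ a + |a|)]
  rcases hmt.eq_or_lt with h | h
  · rw [← h]; exact hmA
  · exfalso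
    obtain ⟨e, he, he2, he3⟩ := h1 m hm0 h (t - m) (by linarith)
    have : m + e ∈ A := ⟨by linarith, by linarith, by linarith⟩
    have := le_csSup hbd this
    linarith

end helper1

section helper2

variable {X : Type*} [MetricSpace X] {κ : X → ℝ} {S : ℝ → (X → EReal) → (X → EReal)}

/-- real valued version of the operators -/
noncomputable def TT (S : ℝ → (X → EReal) → (X → EReal)) (t : ℝ) (v : X → ℝ) (x : X) : ℝ :=
  (S t (ecoe v) x).toReal

lemma memUk_of (hκpos : ∀ x, 0 < κ x) (f : X → EReal) (hf : UpperSemicontinuous f) (R : ℝ)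
    (hR : 0 ≤ R) (h : ∀ x, f x ≤ ((R / κ x : ℝ) : EReal)) : MemUk κ f := by
  refine ⟨hf, fun x => lt_of_le_of_lt (h x) (EReal.coe_lt_top _), R, fun x => ?_⟩
  have h1 : max (f x) 0 ≤ ((R / κ x : ℝ) : EReal) := by
    refine max_le (h x) ?_
    exact_mod_cast div_nonneg hR (hκpos x).le
  calc max (f x) 0 * (κ x : EReal) ≤ ((R / κ x : ℝ) : EReal) * (κ x : EReal) :=
        mul_le_mul_of_nonneg_right h1 (by exact_mod_cast (hκpos x).le)
    _ = (R : EReal) := by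
        rw [← EReal.coe_mul, div_mul_cancel₀ _ (hκpos x).ne']

lemma MemCk.le_div (hκpos : ∀ x, 0 < κ x) {v : X → ℝ} (hv : MemCk κ v) :
    ∃ R, 0 ≤ R ∧ ∀ x, |v x| ≤ R / κ x := by
  obtain ⟨_, r, hr⟩ := hv
  refine ⟨max r 0, le_max_right _ _, fun x => ?_⟩
  rw [le_div_iff₀ (hκpos x)]
  exact (hr x).trans (le_max_left _ _)

lemma memCk_of (hκpos : ∀ x, 0 < κ x) {v : X → ℝ} (hc : Continuous v) (R : ℝ)
    (h : ∀ x, |v x| ≤ R / κ x) : MemCk κ v :=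
  ⟨hc, R, fun x => (le_div_iff₀ (hκpos x)).1 (h x)⟩

lemma memUk_ecoe (hκpos : ∀ x, 0 < κ x) {v : X → ℝ} (hv : MemCk κ v) : MemUk κ (ecoe v) := by
  obtain ⟨R, hR, h⟩ := hv.le_div hκpos
  refine memUk_of hκpos _ ?_ R hR fun x => ?_
  · exact (continuous_coe_real_ereal.comp hv.1).upperSemicontinuous
  · exact EReal.coe_le_coe_iff.2 ((le_abs_self _).trans (h x))

lemma MemCk.add (hκpos : ∀ x, 0 < κ x) {v w : X → ℝ} (hv : MemCk κ v) (hw : MemCk κ w) :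
    MemCk κ (fun x => v x + w x) := by
  obtain ⟨R, hR, h⟩ := hv.le_div hκpos
  obtain ⟨R', hR', h'⟩ := hw.le_div hκpos
  refine memCk_of hκpos (hv.1.add hw.1) (R + R') fun x => ?_
  rw [add_div]
  exact (abs_add_le _ _).trans (add_le_add (h x) (h' x))

lemma MemCk.smul (hκpos : ∀ x, 0 < κ x) {v : X → ℝ} (hv : MemCk κ v) (a : ℝ) :
    MemCk κ (fun x => a * v x) := by
  obtain ⟨R, hR, h⟩ := hv.le_div hκpos
  refine memCk_of hκpos (continuous_const.mul hv.1) (|a| * R) fun x => ?_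
  rw [abs_mul, mul_div_assoc]
  exact mul_le_mul_of_nonneg_left (h x) (abs_nonneg _)

lemma memCk_div (hκc : Continuous κ) (hκpos : ∀ x, 0 < κ x) (R : ℝ) :
    MemCk κ (fun x => R / κ x) := by
  refine memCk_of hκpos (continuous_const.div hκc fun x => (hκpos x).ne') |R| fun x => ?_
  rw [abs_div, abs_of_pos (hκpos x)]

lemma memCk_convex (hκpos : ∀ x, 0 < κ x) : Convex ℝ {v : X → ℝ | MemCk κ v} := by
  intro v hv w hw a b _ _ _
  exact (MemCk.smul hκpos hv a).add hκpos (MemCk.smul hκpos hw b)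

lemma TT_bound (hκpos : ∀ x, 0 < κ x) (hS : AssumptionS κ S) {v : X → ℝ} (hv : MemCk κ v)
    (t : ℝ) (ht : 0 ≤ t) : ∃ C : ℝ, 0 ≤ C ∧ ∀ s, 0 ≤ s → s ≤ t → ∀ x,
      S s (ecoe v) x = (TT S s v x : EReal) ∧ |TT S s v x| ≤ C / κ x := by
  obtain ⟨r, hr, h⟩ := hv.le_div hκpos
  obtain ⟨C, hC, hb⟩ := hS.bounded r t hr ht
  refine ⟨C.toReal, ENNReal.toReal_nonneg, fun s hs hst x => ?_⟩
  have h1 := hb s hs hst v hv fun x => (le_div_iff₀ (hκpos x)).1 (h x)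
  have h2 : (S s (ecoe v) x).abs * ENNReal.ofReal (κ x) ≤ C := le_trans
    (le_iSup (fun x => (S s (ecoe v) x).abs * ENNReal.ofReal (κ x)) x) h1
  have hk : ENNReal.ofReal (κ x) ≠ 0 := by simpa using hκpos x
  have h3 : (S s (ecoe v) x).abs ≠ ⊤ := by
    intro htop
    rw [htop, ENNReal.top_mul hk, top_le_iff] at h2
    exact hC h2
  have h4 : S s (ecoe v) x = (TT S s v x : EReal) := by
    unfold TT
    rw [EReal.coe_toReal]
    · intro hh; rw [hh] at h3; simp at h3
    · intro hh; rw [hh] at h3; simp at h3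
  refine ⟨h4, ?_⟩
  rw [h4, EReal.abs_def, ← ENNReal.ofReal_mul (abs_nonneg _),
    ENNReal.ofReal_le_iff_le_toReal hC] at h2
  rwa [le_div_iff₀ (hκpos x)]

lemma TT_coe (hκpos : ∀ x, 0 < κ x) (hS : AssumptionS κ S) {v : X → ℝ} (hv : MemCk κ v)
    {t : ℝ} (ht : 0 ≤ t) (x : X) : S t (ecoe v) x = (TT S t v x : EReal) := by
  obtain ⟨C, _, h⟩ := TT_bound hκpos hS hv t ht
  exact (h t ht le_rfl x).1

lemma TT_zero (hκpos : ∀ x, 0 < κ x) (hS : AssumptionS κ S) {v : X → ℝ} (hv : MemCk κ v)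
    (x : X) : TT S 0 v x = v x := by
  unfold TT
  rw [hS.idZero _ (memUk_ecoe hκpos hv)]
  rfl

lemma TT_mono (hκpos : ∀ x, 0 < κ x) (hS : AssumptionS κ S) {v w : X → ℝ} (hv : MemCk κ v)
    (hw : MemCk κ w) (h : ∀ x, v x ≤ w x) {t : ℝ} (ht : 0 ≤ t) (x : X) :
    TT S t v x ≤ TT S t w x := by
  have := hS.monotone t ht _ _ (memUk_ecoe hκpos hv) (memUk_ecoe hκpos hw)
    (fun x => EReal.coe_le_coe_iff.2 (h x)) x
  rw [TT_coe hκpos hS hv ht, TT_coe hκpos hS hw ht] at this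
  exact EReal.coe_le_coe_iff.1 this

lemma TT_convex (hκpos : ∀ x, 0 < κ x) (hS : AssumptionS κ S) {t : ℝ} (ht : 0 ≤ t) (x : X) :
    ConvexOn ℝ {v : X → ℝ | MemCk κ v} (fun v => TT S t v x) := by
  refine ⟨memCk_convex hκpos, ?_⟩
  intro v hv w hw a b ha hb hab
  have h := hS.convex t ht _ _ (memUk_ecoe hκpos hv) (memUk_ecoe hκpos hw) a ha (by linarith) x
  have hb' : 1 - a = b := by linarith
  rw [hb'] at h
  have he : (fun y => (a : EReal) * ecoe v y + (b : EReal) * ecoe w y) = ecoe (a • v + b • w) := by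
    funext y
    simp [ecoe]
  rw [he, TT_coe hκpos hS hv ht, TT_coe hκpos hS hw ht,
    TT_coe hκpos hS (memCk_convex hκpos hv hw ha hb hab) ht] at h
  exact_mod_cast h

lemma TT_conv2 (hκpos : ∀ x, 0 < κ x) (hS : AssumptionS κ S) {v w u : X → ℝ} (hv : MemCk κ v)
    (hw : MemCk κ w) {t : ℝ} (ht : 0 ≤ t) (x : X) (a b : ℝ) (ha : 0 ≤ a) (hb : 0 ≤ b)
    (hab : a + b = 1) (hu : ∀ y, u y = a * v y + b * w y) :
    TT S t u x ≤ a * TT S t v x + b * TT S t w x := by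
  have h := (TT_convex hκpos hS ht x).2 hv hw ha hb hab
  have he : a • v + b • w = u := by
    funext y; simp [hu]
  simp only [smul_eq_mul] at h
  rwa [he] at h

lemma TT_zero_fun (hS : AssumptionS κ S) {t : ℝ} (ht : 0 ≤ t) (x : X) :
    TT S t (fun _ => (0:ℝ)) x = 0 := by
  have := hS.zero t ht x
  unfold TT
  have he : ecoe (fun _ : X => (0:ℝ)) = fun _ => (0 : EReal) := by funext y; simp [ecoe]
  rw [he, this]; simp

lemma TT_neg (hκpos : ∀ x, 0 < κ x) (hS : AssumptionS κ S) {v : X → ℝ} (hv : MemCk κ v)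
    {t : ℝ} (ht : 0 ≤ t) (x : X) : - TT S t (fun y => - v y) x ≤ TT S t v x := by
  have hn : MemCk κ (fun y => - v y) := by simpa using MemCk.smul hκpos hv (-1)
  have h := TT_conv2 hκpos hS hv hn ht x (1/2) (1/2) (by norm_num) (by norm_num)
    (by norm_num) (u := fun _ => (0:ℝ)) (fun y => by ring)
  rw [TT_zero_fun hS ht] at h
  linarith

lemma env_memUk (hκc : Continuous κ) (hκpos : ∀ x, 0 < κ x) (F : ℕ → X → EReal) (K : ℕ)
    (R : ℝ) (hR : 0 ≤ R)
    (h : ∀ j, K ≤ j → ∀ y, F j y ≤ ((R / κ y : ℝ) : EReal)) : MemUk κ (env F K) := by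
  refine memUk_of hκpos _ (env_usc F K) R hR fun x => ?_
  exact env_le F K (fun y => ((R / κ y : ℝ) : EReal))
    (continuous_coe_real_ereal.comp (continuous_const.div hκc fun x => (hκpos x).ne')) h x

/-- continuity along Gamma-limsup -/
lemma gamma_cont (hκc : Continuous κ) (hκpos : ∀ x, 0 < κ x) (hS : AssumptionS κ S)
    (F : ℕ → X → EReal) (K : ℕ) (R : ℝ) (hR : 0 ≤ R)
    (h : ∀ j, K ≤ j → ∀ y, F j y ≤ ((R / κ y : ℝ) : EReal))
    (hF : ∀ j, K ≤ j → MemUk κ (F j))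
    (G : X → EReal) (hG : MemUk κ G)
    (hFG : ∀ x, ∀ b : ℝ, G x < b → ∀ᶠ p in (atTop : Filter ℕ) ×ˢ 𝓝 x, F p.1 p.2 ≤ b)
    {t : ℝ} (ht : 0 ≤ t) (z : X) (b : EReal) (hb : S t G z < b) :
    ∀ᶠ j in atTop, S t (F j) z < b := by
  have hE : ∀ k, MemUk κ (env F (k + K)) := fun k =>
    env_memUk hκc hκpos F _ R hR fun j hj => h j (by omega)
  let I : X → EReal := fun x => ⨅ k, env F (k + K) x
  have hI : MemUk κ I := by
    refine memUk_of hκpos _ (upperSemicontinuous_iInf fun k => env_usc F (k + K)) R hR fun x => ?_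
    refine (iInf_le _ 0).trans ?_
    exact env_le F _ (fun y => ((R / κ y : ℝ) : EReal))
      (continuous_coe_real_ereal.comp (continuous_const.div hκc fun x => (hκpos x).ne'))
      (fun j hj => h j (by omega)) x
  have hIG : ∀ x, I x ≤ G x := by
    intro x
    refine le_of_forall_gt_imp_ge_of_dense fun a ha => ?_
    obtain ⟨r, hr1, hr2⟩ := EReal.lt_iff_exists_real_btwn.1 ha
    obtain ⟨k, hk⟩ := env_le_of_eventually F x r (hFG x r hr1)
    exact ((iInf_le _ k).trans (hk (k + K) (by omega))).trans hr2.le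
  have h1 := hS.contAbove t ht (fun k => env F (k + K)) I hE hI
    (fun x a b hab => env_antitone F x (by omega)) (fun x => rfl) z
  have h2 : (⨅ k, S t (env F (k + K)) z) < b := by
    rw [h1]
    exact lt_of_le_of_lt (hS.monotone t ht _ _ hI hG hIG z) hb
  obtain ⟨k, hk⟩ := iInf_lt_iff.1 h2
  filter_upwards [eventually_ge_atTop (k + K)] with j hj
  refine lt_of_le_of_lt ?_ hk
  exact hS.monotone t ht _ _ (hF j (by omega)) (hE k) (fun x => le_env F hj x) z

/-- lower semicontinuity along continuous convergence -/
lemma TT_lsc (hκc : Continuous κ) (hκpos : ∀ x, 0 < κ x) (hS : AssumptionS κ S)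
    (vn : ℕ → X → ℝ) (v : X → ℝ) (hv : MemCk κ v) (K : ℕ) (R : ℝ)
    (hc : ∀ j, K ≤ j → Continuous (vn j))
    (hR : ∀ j, K ≤ j → ∀ y, |vn j y| ≤ R / κ y)
    (hconv : ∀ x, Tendsto (fun p : ℕ × X => vn p.1 p.2) (atTop ×ˢ 𝓝 x) (𝓝 (v x)))
    {t : ℝ} (ht : 0 ≤ t) (z : X) (ε : ℝ) (hε : 0 < ε) :
    ∀ᶠ j in atTop, TT S t v z ≤ TT S t (vn j) z + ε := by
  obtain ⟨R', hR'0, hR'⟩ := hv.le_div hκpos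
  have hvn : ∀ j, K ≤ j → MemCk κ (vn j) := fun j hj => memCk_of hκpos (hc j hj) R (hR j hj)
  let w : ℕ → X → ℝ := fun j y => 2 * v y + (-1) * vn j y
  have hw : ∀ j, K ≤ j → MemCk κ (w j) := fun j hj =>
    (MemCk.smul hκpos hv 2).add hκpos (MemCk.smul hκpos (hvn j hj) (-1))
  have hwle : ∀ j, K ≤ j → ∀ y, w j y ≤ (2 * R' + |R|) / κ y := by
    intro j hj y
    have h1 := (le_abs_self _).trans (hR' y)
    have h2 := (neg_le_abs _).trans (hR j hj y)
    have h3 : R / κ y ≤ |R| / κ y := div_le_div_of_nonneg_right (le_abs_self _) (hκpos y).le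
    have : (2 * R' + |R|) / κ y = 2 * (R' / κ y) + |R| / κ y := by ring
    rw [this]
    simp only [w]
    linarith
  have hg := gamma_cont hκc hκpos hS (fun j => ecoe (w j)) K (2 * R' + |R|)
    (by positivity) (fun j hj y => EReal.coe_le_coe_iff.2 (hwle j hj y))
    (fun j hj => memUk_ecoe hκpos (hw j hj)) (ecoe v) (memUk_ecoe hκpos hv)
    (fun x b hb => by
      have hb' : v x < b := EReal.coe_lt_coe_iff.1 hb
      have h1 : Tendsto (fun p : ℕ × X => w p.1 p.2) (atTop ×ˢ 𝓝 x)
          (𝓝 (2 * v x + (-1) * v x)) := by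
        refine Tendsto.add ?_ ((hconv x).const_mul _)
        exact ((hv.1.tendsto x).comp tendsto_snd).const_mul 2
      have h2 : 2 * v x + (-1) * v x < b := by linarith
      exact (h1.eventually (gt_mem_nhds h2)).mono fun p hp => EReal.coe_le_coe_iff.2 hp.le)
    ht z (((TT S t v z + ε : ℝ)) : EReal)
    (by rw [TT_coe hκpos hS hv ht]; exact EReal.coe_lt_coe_iff.2 (by linarith))
  filter_upwards [hg, eventually_ge_atTop K] with j hj hjK
  rw [TT_coe hκpos hS (hw j hjK) ht, EReal.coe_lt_coe_iff] at hj
  have h := TT_conv2 hκpos hS (hvn j hjK) (hw j hjK) ht z (1/2) (1/2)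
    (by norm_num) (by norm_num) (by norm_num) (u := v) (fun y => by simp only [w]; ring)
  linarith

end helper2

section helper3

set_option linter.unusedSectionVars false

variable {X : Type*} [NormedAddCommGroup X]
    [TopologicalSpace.SeparableSpace X] [MeasurableSpace X] [BorelSpace X]
    {κ : X → ℝ} {S : ℝ → (X → EReal) → (X → EReal)}

lemma simple_int (μ : Measure X) [IsProbabilityMeasure μ] (Y : SimpleFunc X X) (g : X → ℝ) :
    ∫ y, g (Y y) ∂μ = ∑ v ∈ Y.range, μ.real (Y ⁻¹' {v}) * g v := by
  have h : ∀ y, g (Y y) = ∑ v ∈ Y.range, (Y ⁻¹' {v}).indicator (fun _ => g v) y := by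
    intro y
    rw [Finset.sum_eq_single (Y y)]
    · simp
    · intro b _ hb
      rw [Set.indicator_of_notMem]
      simpa using fun h => hb h.symm
    · intro h
      exact absurd (Y.mem_range_self y) h
  simp_rw [h]
  rw [integral_finsetSum]
  · refine Finset.sum_congr rfl fun v _ => ?_
    rw [integral_indicator_const _ (Y.measurableSet_fiber v), smul_eq_mul]
  · intro v _
    exact (integrable_const _).indicator (Y.measurableSet_fiber v)

lemma shift_bound (hκpos : ∀ x, 0 < κ x) {c : ℝ}
    (hc : ∀ x y : X, ‖y‖ ≤ 1 → κ x / κ (x - y) ≤ c) {R : ℝ} (hR : 0 ≤ R)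
    (z y : X) (hy : ‖y‖ ≤ 1) : R / κ (z - y) ≤ R * c / κ z := by
  have h := hc z y hy
  rw [div_le_iff₀ (hκpos _)] at h
  rw [div_le_div_iff₀ (hκpos _) (hκpos _)]
  nlinarith

lemma conv_integrable (hκpos : ∀ x, 0 < κ x) {c : ℝ}
    (hc : ∀ x y : X, ‖y‖ ≤ 1 → κ x / κ (x - y) ≤ c) (μ : Measure X) [IsProbabilityMeasure μ]
    (hsupp : ∀ᵐ y ∂μ, ‖y‖ ≤ 1) {f : X → ℝ} (hf : MemCk κ f) (x : X) :
    Integrable (fun y => f (x - y)) μ := by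
  obtain ⟨R, hR, h⟩ := hf.le_div hκpos
  refine Integrable.mono' (integrable_const (R * c / κ x)) ?_ ?_
  · exact (hf.1.comp (continuous_const.sub continuous_id)).aestronglyMeasurable
  · filter_upwards [hsupp] with y hy
    exact (h _).trans (shift_bound hκpos hc hR x y hy)

lemma erealToENNReal_coe (a : ℝ) : erealToENNReal (max (a : EReal) 0) = ENNReal.ofReal a := by
  unfold erealToENNReal
  have : max (a : EReal) 0 = ((max a 0 : ℝ) : EReal) := by
    exact (EReal.coe_strictMono.monotone.map_max (a := a) (b := 0)).symm
  rw [this, if_neg (EReal.coe_ne_top _), EReal.toReal_coe]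
  rcases le_total a 0 with h | h
  · rw [max_eq_right h, ENNReal.ofReal_of_nonpos h, ENNReal.ofReal_zero]
  · rw [max_eq_left h]

lemma conv_eq (hκpos : ∀ x, 0 < κ x) {c : ℝ}
    (hc : ∀ x y : X, ‖y‖ ≤ 1 → κ x / κ (x - y) ≤ c) (μ : Measure X) [IsProbabilityMeasure μ]
    (hsupp : ∀ᵐ y ∂μ, ‖y‖ ≤ 1) {f : X → ℝ} (hf : MemCk κ f) (x : X) (a : ℝ)
    (h : econv μ (ecoe f) x = (a : EReal)) : a = ∫ y, f (x - y) ∂μ := by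
  have hi := conv_integrable hκpos hc μ hsupp hf x
  unfold econv at h
  have h1 : ∀ y, erealToENNReal (max (ecoe f (x - y)) 0) = ENNReal.ofReal (f (x - y)) :=
    fun y => erealToENNReal_coe _
  have h2 : ∀ y, erealToENNReal (max (-ecoe f (x - y)) 0) = ENNReal.ofReal (-f (x - y)) := by
    intro y
    rw [← erealToENNReal_coe]
    simp [ecoe]
  simp_rw [h1, h2] at h
  have h3 : (∫⁻ y, ENNReal.ofReal (f (x - y)) ∂μ) ≠ ⊤ := hi.lintegral_lt_top.ne
  have h4 : (∫⁻ y, ENNReal.ofReal (-f (x - y)) ∂μ) ≠ ⊤ := hi.neg.lintegral_lt_top.ne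
  rw [integral_eq_lintegral_pos_part_sub_lintegral_neg_part hi]
  rw [← EReal.coe_ennreal_toReal h3, ← EReal.coe_ennreal_toReal h4, ← EReal.coe_sub,
    EReal.coe_eq_coe_iff] at h
  exact h.symm

lemma conv_sub_le (hκpos : ∀ x, 0 < κ x) {c : ℝ}
    (hc : ∀ x y : X, ‖y‖ ≤ 1 → κ x / κ (x - y) ≤ c) (μ : Measure X) [IsProbabilityMeasure μ]
    {r : ℝ} (hr : r ≤ 1)
    (hsupp : ∀ᵐ y ∂μ, ‖y‖ ≤ r) {f : X → ℝ} (hf : MemCk κ f) (x : X) (a ε : ℝ)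
    (h : ∀ y, ‖y‖ ≤ r → |f (x - y) - a| ≤ ε) : |∫ y, f (x - y) ∂μ - a| ≤ ε := by
  have hi := conv_integrable hκpos hc μ (hsupp.mono fun y hy => hy.trans hr) hf x
  have h1 : ∫ y, f (x - y) ∂μ - a = ∫ y, (f (x - y) - a) ∂μ := by
    rw [integral_sub hi (integrable_const a)]; simp
  rw [h1]
  have := norm_integral_le_of_norm_le_const (μ := μ) (f := fun y => f (x - y) - a) (C := ε)
    (hsupp.mono fun y hy => h y hy)
  simpa using this

lemma jensen (hκc : Continuous κ) (hκpos : ∀ x, 0 < κ x) (hS : AssumptionS κ S) {c : ℝ}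
    (hc : ∀ x y : X, ‖y‖ ≤ 1 → κ x / κ (x - y) ≤ c) (μ : Measure X) [IsProbabilityMeasure μ]
    {r : ℝ} (hr0 : 0 ≤ r) (hr : r ≤ 1)
    (hsupp : ∀ᵐ y ∂μ, ‖y‖ ≤ r) {f : X → ℝ} (hf : MemCk κ f) (vb : X → ℝ) (hvb : MemCk κ vb)
    (hvb2 : ∀ x, vb x = ∫ y, f (x - y) ∂μ) {t : ℝ} (ht : 0 ≤ t) (x : X) (M : ℝ)
    (hM : ∀ y, ‖y‖ ≤ r → TT S t (fun z => f (z - y)) x ≤ f (x - y) + M) :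
    TT S t vb x ≤ vb x + M := by
  obtain ⟨R, hR, hfR⟩ := hf.le_div hκpos
  have h0 : (0 : X) ∈ Metric.closedBall (0 : X) r := Metric.mem_closedBall_self hr0
  obtain ⟨Y, hY, hYt⟩ : ∃ Y : ℕ → SimpleFunc X X, (∀ N y, ‖Y N y‖ ≤ r) ∧
      ∀ y : X, ‖y‖ ≤ r → Tendsto (fun N => Y N y) atTop (𝓝 y) := by
    refine ⟨fun N => SimpleFunc.approxOn id measurable_id (Metric.closedBall (0:X) r) 0 h0 N,
      fun N y => ?_, fun y hy => ?_⟩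
    · have := SimpleFunc.approxOn_mem measurable_id h0 N y
      simpa using this
    · have := SimpleFunc.tendsto_approxOn (f := id) measurable_id h0 (x := y)
        (subset_closure (by simpa using hy))
      simpa using this
  let w : ℕ → X → ℝ := fun N v => μ.real (Y N ⁻¹' {v})
  let vN : ℕ → X → ℝ := fun N z => ∑ v ∈ (Y N).range, w N v * f (z - v)
  have hvN : ∀ N z, vN N z = ∫ y, f (z - Y N y) ∂μ := fun N z =>
    (simple_int μ (Y N) (fun v => f (z - v))).symm
  have hw0 : ∀ N v, 0 ≤ w N v := fun N v => measureReal_nonneg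
  have hw1 : ∀ N, ∑ v ∈ (Y N).range, w N v = 1 := fun N => by
    have := simple_int μ (Y N) (fun _ => (1:ℝ))
    simpa using this.symm
  have hvr : ∀ N, ∀ v ∈ (Y N).range, ‖v‖ ≤ r := by
    intro N v hv
    obtain ⟨y, rfl⟩ := SimpleFunc.mem_range.1 hv
    exact hY N y
  have hsh : ∀ v : X, ‖v‖ ≤ r → ∀ z, |f (z - v)| ≤ R * c / κ z := fun v hv z =>
    (hfR _).trans (shift_bound hκpos hc hR z v (hv.trans hr))
  have hshm : ∀ v : X, ‖v‖ ≤ r → MemCk κ (fun z => f (z - v)) := fun v hv =>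
    memCk_of hκpos (hf.1.comp (continuous_id.sub continuous_const)) _ (hsh v hv)
  have hvNc : ∀ N, Continuous (vN N) := fun N =>
    continuous_finsetSum _ fun v _ =>
      continuous_const.mul (hf.1.comp (continuous_id.sub continuous_const))
  have hvNb : ∀ N z, |vN N z| ≤ R * c / κ z := by
    intro N z
    calc |vN N z| ≤ ∑ v ∈ (Y N).range, |w N v * f (z - v)| := Finset.abs_sum_le_sum_abs _ _
      _ ≤ ∑ v ∈ (Y N).range, w N v * (R * c / κ z) := by
          refine Finset.sum_le_sum fun v hv => ?_
          rw [abs_mul, abs_of_nonneg (hw0 N v)]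
          exact mul_le_mul_of_nonneg_left (hsh v (hvr N v hv) z) (hw0 N v)
      _ = R * c / κ z := by rw [← Finset.sum_mul, hw1, one_mul]
  have hconv : ∀ z, Tendsto (fun p : ℕ × X => vN p.1 p.2) (atTop ×ˢ 𝓝 z) (𝓝 (vb z)) := by
    intro z
    simp_rw [hvN, hvb2]
    have hbd : ∀ᶠ z' in 𝓝 z, R * c / κ z' < R * c / κ z + 1 := by
      have : ContinuousAt (fun z' => R * c / κ z') z :=
        (continuous_const.div hκc fun x => (hκpos x).ne').continuousAt
      exact this.eventually_lt continuousAt_const (by linarith)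
    refine tendsto_integral_filter_of_dominated_convergence (fun _ => R * c / κ z + 1) ?_ ?_
      (integrable_const _) ?_
    · refine Eventually.of_forall fun p => ?_
      have : Measurable fun y => f (p.2 - Y p.1 y) :=
        hf.1.measurable.comp ((continuous_const.sub continuous_id).measurable.comp
          (Y p.1).measurable)
      exact this.aestronglyMeasurable
    · filter_upwards [tendsto_snd.eventually hbd] with p hp
      refine Eventually.of_forall fun y => ?_
      exact (hsh _ (hY _ _) _).trans hp.le
    · filter_upwards [hsupp] with y hy
      refine (hf.1.tendsto (z - y)).comp ?_
      exact tendsto_snd.sub ((hYt y hy).comp tendsto_fst)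
  have hj : ∀ N, TT S t (vN N) x ≤ vN N x + M := by
    intro N
    have h1 := (TT_convex hκpos hS ht x).map_sum_le (t := (Y N).range) (w := w N)
      (p := fun v z => f (z - v)) (fun v _ => hw0 N v) (hw1 N) (fun v hv => hshm v (hvr N v hv))
    have h2 : (∑ v ∈ (Y N).range, w N v • (fun z => f (z - v))) = vN N := by
      funext z
      simp [vN, Finset.sum_apply]
    simp only [smul_eq_mul] at h1
    rw [h2] at h1
    refine h1.trans ?_
    calc ∑ v ∈ (Y N).range, w N v * TT S t (fun z => f (z - v)) x
        ≤ ∑ v ∈ (Y N).range, w N v * (f (x - v) + M) :=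
          Finset.sum_le_sum fun v hv => mul_le_mul_of_nonneg_left (hM v (hvr N v hv)) (hw0 N v)
      _ = vN N x + M := by
          simp_rw [mul_add]
          rw [Finset.sum_add_distrib, ← Finset.sum_mul, hw1, one_mul]
  clear_value vN
  refine le_of_forall_pos_le_add fun ε hε => ?_
  have hl := TT_lsc hκc hκpos hS vN vb hvb 0 (R * c) (fun j _ => hvNc j) (fun j _ => hvNb j)
    hconv ht x (ε / 2) (by linarith)
  have hx : Tendsto (fun N => vN N x) atTop (𝓝 (vb x)) := by
    have : Tendsto (fun N : ℕ => (N, x)) atTop (atTop ×ˢ 𝓝 x) :=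
      tendsto_id.prodMk tendsto_const_nhds
    exact Tendsto.comp (g := fun p : ℕ × X => vN p.1 p.2) (hconv x) this
  have hx' : ∀ᶠ N in atTop, vN N x < vb x + ε / 2 := hx.eventually (gt_mem_nhds (by linarith))
  obtain ⟨N, h1, h2⟩ := (hl.and hx').exists
  have := hj N
  linarith

end helper3

section helper4

variable {X : Type*} [MetricSpace X] {κ : X → ℝ} {S : ℝ → (X → EReal) → (X → EReal)}

lemma diffQuot_coe (hκpos : ∀ x, 0 < κ x) (hS : AssumptionS κ S) {v : X → ℝ} (hv : MemCk κ v)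
    {h : ℝ} (hh : 0 ≤ h) (x : X) :
    diffQuot S v h x = ((h⁻¹ * (TT S h v x - v x) : ℝ) : EReal) := by
  unfold diffQuot
  rw [TT_coe hκpos hS hv hh, EReal.coe_mul, EReal.coe_sub]

lemma diffQuot_le_iff (hκpos : ∀ x, 0 < κ x) (hS : AssumptionS κ S) {v : X → ℝ}
    (hv : MemCk κ v) {h : ℝ} (hh : 0 < h) (x : X) (a : ℝ) :
    diffQuot S v h x ≤ (a : EReal) ↔ TT S h v x ≤ v x + a * h := by
  rw [diffQuot_coe hκpos hS hv hh.le, EReal.coe_le_coe_iff, inv_mul_le_iff₀ hh]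
  constructor <;> intro h <;> linarith

lemma UpperLip.upper (hκpos : ∀ x, 0 < κ x) (hS : AssumptionS κ S) {v : X → ℝ}
    (hv : UpperLip κ S v) : ∃ h₀ > (0:ℝ), ∃ c ≥ (0:ℝ), ∀ h, 0 ≤ h → h ≤ h₀ → ∀ x,
      TT S h v x ≤ v x + c / κ x * h := by
  obtain ⟨hm, _, _, h₀, hh₀, c, hc, H⟩ := hv
  refine ⟨h₀, hh₀, c, hc, fun h h0 h1 x => ?_⟩
  have h2 := H h h0 h1 x
  rw [TT_coe hκpos hS hm h0, ← EReal.coe_sub] at h2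
  have h3 : (((TT S h v x - v x) * κ x : ℝ) : EReal) ≤ ((c * h : ℝ) : EReal) := by
    refine le_trans ?_ h2
    rw [EReal.coe_mul]
    exact mul_le_mul_of_nonneg_right (le_max_left _ _) (by exact_mod_cast (hκpos x).le)
  rw [EReal.coe_le_coe_iff, ← le_div_iff₀ (hκpos x)] at h3
  have : c * h / κ x = c / κ x * h := by ring
  linarith

lemma UpperLip.TT_mem (hκpos : ∀ x, 0 < κ x) (hS : AssumptionS κ S) {v : X → ℝ}
    (hv : UpperLip κ S v) {h : ℝ} (hh : 0 ≤ h) : MemCk κ (TT S h v) := by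
  obtain ⟨w, hw, hw2⟩ := hv.2.1 h hh
  have : TT S h v = w := by
    funext x
    have := hw2 x
    rw [TT_coe hκpos hS hv.1 hh] at this
    exact EReal.coe_eq_coe_iff.1 this
  rw [this]; exact hw

lemma UpperLip.semi (hκpos : ∀ x, 0 < κ x) (hS : AssumptionS κ S) {v : X → ℝ}
    (hv : UpperLip κ S v) {s h : ℝ} (hs : 0 ≤ s) (hh : 0 ≤ h) (x : X) :
    TT S (s + h) v x = TT S s (TT S h v) x := by
  have h1 : S h (ecoe v) = ecoe (TT S h v) := by
    funext y; exact TT_coe hκpos hS hv.1 hh y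
  unfold TT
  rw [hv.2.2.1 s h hs hh, h1]
  rfl

/-- one step estimate -/
lemma UpperLip.step (hκpos : ∀ x, 0 < κ x) (hS : AssumptionS κ S) {v : X → ℝ}
    (hv : UpperLip κ S v) {s h : ℝ} (hs : 0 ≤ s) (hh : 0 < h) (hh1 : h ≤ 1) (x : X) :
    TT S (s + h) v x ≤ TT S s v x +
      h * (TT S s (fun y => v y + h⁻¹ * (TT S h v y - v y)) x - TT S s v x) := by
  have hm : MemCk κ (fun y => v y + h⁻¹ * (TT S h v y - v y)) := by
    refine MemCk.add hκpos hv.1 (MemCk.smul hκpos ?_ _)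
    have := MemCk.add hκpos (hv.TT_mem hκpos hS hh.le) (MemCk.smul hκpos hv.1 (-1))
    convert this using 2
    ring
  rw [hv.semi hκpos hS hs hh.le]
  have := TT_conv2 hκpos hS hv.1 hm hs x (1 - h) h (by linarith) hh.le (by ring)
    (u := TT S h v) (fun y => by field_simp; ring)
  linarith

lemma growth (hκc : Continuous κ) (hκpos : ∀ x, 0 < κ x) (hS : AssumptionS κ S) {v : X → ℝ}
    (hv : UpperLip κ S v) (gn : X → EReal) (hg : IsGammaDeriv S v gn) (G : X → EReal)
    (hG : MemUk κ G) (hle : ∀ y, (v y : EReal) + gn y ≤ G y) (z : X) {t : ℝ} (ht : 0 ≤ t) (a : ℝ)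
    (h : ∀ s, 0 ≤ s → s ≤ t → S s G z < ((TT S s v z + a : ℝ) : EReal)) :
    TT S t v z ≤ v z + a * t := by
  obtain ⟨h₀, hh₀, c, hc, hup⟩ := hv.upper hκpos hS
  obtain ⟨Rv, hRv, hvR⟩ := hv.1.le_div hκpos
  let q : ℕ → ℝ := fun k => 1 / ((k:ℝ) + 1)
  have hq0 : ∀ k, 0 < q k := fun k => Nat.one_div_pos_of_nat
  have hq : Tendsto q atTop (𝓝 0) := tendsto_one_div_add_atTop_nhds_zero_nat
  let W : ℝ → X → ℝ := fun h y => v y + h⁻¹ * (TT S h v y - v y)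
  have hW : ∀ h, 0 ≤ h → MemCk κ (W h) := by
    intro h hh
    refine MemCk.add hκpos hv.1 (MemCk.smul hκpos ?_ _)
    have := MemCk.add hκpos (hv.TT_mem hκpos hS hh) (MemCk.smul hκpos hv.1 (-1))
    convert this using 2
    ring
  have hWle : ∀ h, 0 < h → h ≤ h₀ → ∀ y, W h y ≤ v y + c / κ y := by
    intro h hh hh1 y
    have h1 := hup h hh.le hh1 y
    have h2 : h⁻¹ * (TT S h v y - v y) ≤ c / κ y := by
      rw [inv_mul_le_iff₀ hh]; linarith
    simp only [W]
    linarith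
  have hWle2 : ∀ h, 0 < h → h ≤ h₀ → ∀ y, W h y ≤ (Rv + c) / κ y := by
    intro h hh hh1 y
    have h1 := hWle h hh hh1 y
    have h2 := (le_abs_self _).trans (hvR y)
    rw [add_div]; linarith
  obtain ⟨K, hK⟩ : ∃ K, ∀ k, K ≤ k → q k ≤ h₀ := by
    have := hq.eventually (gt_mem_nhds hh₀)
    obtain ⟨K, hK⟩ := eventually_atTop.1 this
    exact ⟨K, fun k hk => (hK k hk).le⟩
  have hFG : ∀ x, ∀ b : ℝ, G x < b →
      ∀ᶠ p in (atTop : Filter ℕ) ×ˢ 𝓝 x, ecoe (W (q p.1)) p.2 ≤ b := by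
    intro x b hb
    have h1 : gn x < ((b - v x : ℝ) : EReal) := by
      have h2 := lt_of_le_of_lt (hle x) hb
      generalize gn x = e at h2 ⊢
      induction e using EReal.rec with
      | bot => exact EReal.bot_lt_coe _
      | coe e =>
        rw [← EReal.coe_add, EReal.coe_lt_coe_iff] at h2
        rw [EReal.coe_lt_coe_iff]; linarith
      | top => simp at h2
    obtain ⟨r, hr1, hr2⟩ := EReal.lt_iff_exists_real_btwn.1 h1
    rw [EReal.coe_lt_coe_iff] at hr2
    have h3 := eventually_of_seq (fun n => diffQuot S v (q n)) x (gn x)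
      ((hg q hq0 hq x).1) r hr1
    have h4 : ∀ᶠ y in 𝓝 x, v y < b - r :=
      hv.1.1.continuousAt.eventually_lt continuousAt_const (by linarith)
    filter_upwards [h3, tendsto_snd.eventually h4] with p hp1 hp2
    rw [diffQuot_coe hκpos hS hv.1 (hq0 _).le, EReal.coe_lt_coe_iff] at hp1
    refine EReal.coe_le_coe_iff.2 ?_
    simp only [W]
    linarith
  -- bounds
  have hWb : MemCk κ (fun y => v y + c / κ y) := hv.1.add hκpos (memCk_div hκc hκpos c)
  obtain ⟨C1, hC1, hb1⟩ := TT_bound hκpos hS hWb t ht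
  obtain ⟨C2, hC2, hb2⟩ := TT_bound hκpos hS hv.1 t ht
  have hz0 := TT_zero hκpos hS hv.1 z
  have main := dini_le (fun s => TT S s v z) t a (C1 / κ z + C2 / κ z) (min h₀ 1) ht
    (lt_min hh₀ one_pos)
    (add_nonneg (div_nonneg hC1 (hκpos z).le) (div_nonneg hC2 (hκpos z).le)) ?_ ?_
  · rw [← hz0]; exact main
  · intro s hs hst η hη
    have h5 := gamma_cont hκc hκpos hS (fun k => ecoe (W (q k))) K (Rv + c) (by linarith)
      (fun j hj y => EReal.coe_le_coe_iff.2 (hWle2 _ (hq0 j) (hK j hj) y))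
      (fun j _ => memUk_ecoe hκpos (hW _ (hq0 j).le)) G hG hFG hs z _ (h s hs hst.le)
    have h6 := hq.eventually (gt_mem_nhds hη)
    have h7 := hq.eventually (gt_mem_nhds (one_pos : (0:ℝ) < 1))
    obtain ⟨k, hk1, hk2, hk3⟩ := (h5.and (h6.and h7)).exists
    refine ⟨q k, hq0 k, hk2, ?_⟩
    rw [TT_coe hκpos hS (hW _ (hq0 k).le) hs, EReal.coe_lt_coe_iff] at hk1
    have h8 := hv.step hκpos hS hs (hq0 k) hk3.le z
    have h9 : TT S s (W (q k)) z - TT S s v z ≤ a := by linarith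
    have h10 := mul_le_mul_of_nonneg_left h9 (hq0 k).le
    have h11 : TT S (s + q k) v z ≤ TT S s v z + q k * (TT S s (W (q k)) z - TT S s v z) := h8
    change TT S (s + q k) v z ≤ TT S s v z + a * q k
    linarith
  · intro r e hr he hre heη
    change TT S (r + e) v z ≤ TT S r v z + (C1 / κ z + C2 / κ z) * e
    rcases he.eq_or_lt with h0 | h0
    · rw [← h0]; simp
    have h8 : TT S (r + e) v z ≤ TT S r v z + e * (TT S r (W e) z - TT S r v z) :=
      hv.step hκpos hS hr h0 (heη.trans (min_le_right _ _)) z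
    have h9 := TT_mono hκpos hS (hW e he) hWb (hWle e h0 (heη.trans (min_le_left _ _))) hr z
    have h10 := (le_abs_self _).trans (hb1 r hr (by linarith) z).2
    have h11 := (neg_le_abs _).trans (hb2 r hr (by linarith) z).2
    have h12 : TT S r (W e) z - TT S r v z ≤ C1 / κ z + C2 / κ z := by linarith
    have h13 := mul_le_mul_of_nonneg_left h12 he
    linarith

lemma claim1 (hκc : Continuous κ) (hκpos : ∀ x, 0 < κ x) (hS : AssumptionS κ S)
    (f : X → ℝ) (hf : MemCk κ f) (vn : ℕ → X → ℝ) (gn : ℕ → X → EReal)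
    (hvn : ∀ n, UpperLip κ S (vn n)) (hg : ∀ n, IsGammaDeriv S (vn n) (gn n))
    (K : ℕ) (R : ℝ) (hR : 0 ≤ R) (hvR : ∀ n, K ≤ n → ∀ y, |vn n y| ≤ R / κ y)
    (hgR : ∀ n, K ≤ n → ∀ y, gn n y ≤ ((R / κ y : ℝ) : EReal))
    (hconv : ∀ x, Tendsto (fun p : ℕ × X => vn p.1 p.2) (atTop ×ˢ 𝓝 x) (𝓝 (f x)))
    (x : X) (a a' : ℝ) (haa : a < a')
    (ha : ∀ᶠ p in (atTop : Filter ℕ) ×ˢ 𝓝 x, gn p.1 p.2 ≤ (a : EReal)) :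
    ∃ δ > (0:ℝ), ∀ t, 0 ≤ t → t < δ → ∀ z, dist z x < δ → TT S t f z ≤ f z + a' * t := by
  set η := (a' - a) / 4 with hη
  have hη0 : 0 < η := by rw [hη]; linarith
  let F : ℕ → X → EReal := fun n y => (vn n y : EReal) + gn n y
  let F2 : ℕ → X → EReal := fun n => ecoe (fun y => - vn n y)
  have hF : ∀ n, K ≤ n → ∀ y, F n y ≤ (((2 * R) / κ y : ℝ) : EReal) := by
    intro n hn y
    have : (2 * R) / κ y = R / κ y + R / κ y := by ring
    rw [this, EReal.coe_add]
    exact add_le_add (EReal.coe_le_coe_iff.2 ((le_abs_self _).trans (hvR n hn y))) (hgR n hn y)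
  have hF2 : ∀ n, K ≤ n → ∀ y, F2 n y ≤ ((R / κ y : ℝ) : EReal) := fun n hn y =>
    EReal.coe_le_coe_iff.2 ((neg_le_abs _).trans (hvR n hn y))
  have e1 : ∀ᶠ p in (atTop : Filter ℕ) ×ˢ 𝓝 x, F p.1 p.2 ≤ ((f x + η + a : ℝ) : EReal) := by
    filter_upwards [ha, (hconv x).eventually (gt_mem_nhds (show f x < f x + η by linarith))]
      with p h1 h2
    rw [EReal.coe_add (f x + η)]
    exact add_le_add (EReal.coe_le_coe_iff.2 h2.le) h1
  have e2 : ∀ᶠ p in (atTop : Filter ℕ) ×ˢ 𝓝 x, F2 p.1 p.2 ≤ ((-f x + η : ℝ) : EReal) := by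
    filter_upwards [(hconv x).eventually (lt_mem_nhds (show f x - η < f x by linarith))] with p h2
    exact EReal.coe_le_coe_iff.2 (by linarith)
  obtain ⟨K1, hK1⟩ := env_le_of_eventually F x _ e1
  obtain ⟨K2, hK2⟩ := env_le_of_eventually F2 x _ e2
  obtain ⟨L, hL0, hL1, hL2⟩ : ∃ L, K ≤ L ∧ K1 ≤ L ∧ K2 ≤ L :=
    ⟨max K (max K1 K2), by simp, by simp, by simp⟩
  have m1 : MemUk κ (env F L) := env_memUk hκc hκpos F L (2 * R) (by linarith)
    fun j hj => hF j (hL0.trans hj)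
  have m2 : MemUk κ (env F2 L) := env_memUk hκc hκpos F2 L R hR
    fun j hj => hF2 j (hL0.trans hj)
  have g1 : gammaLimsupAt (fun s => S s (env F L)) 0 x < ((f x + 2 * η + a : ℝ) : EReal) := by
    refine lt_of_le_of_lt (hS.gammaUsc 0 le_rfl _ m1 x) ?_
    rw [hS.idZero _ m1]
    exact lt_of_le_of_lt (hK1 L hL1) (EReal.coe_lt_coe_iff.2 (by linarith))
  have g2 : gammaLimsupAt (fun s => S s (env F2 L)) 0 x < ((-f x + 2 * η : ℝ) : EReal) := by
    refine lt_of_le_of_lt (hS.gammaUsc 0 le_rfl _ m2 x) ?_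
    rw [hS.idZero _ m2]
    exact lt_of_le_of_lt (hK2 L hL2) (EReal.coe_lt_coe_iff.2 (by linarith))
  obtain ⟨δ1, hδ1, d1⟩ := eventually_prod_of_seq _ x _ g1
  obtain ⟨δ2, hδ2, d2⟩ := eventually_prod_of_seq _ x _ g2
  refine ⟨min δ1 δ2, lt_min hδ1 hδ2, fun t ht htδ z hz => ?_⟩
  have hneg : ∀ n, MemCk κ (fun y => - vn n y) := fun n => by
    simpa using MemCk.smul hκpos (hvn n).1 (-1)
  have key : ∀ n, L ≤ n → TT S t (vn n) z ≤ vn n z + a' * t := by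
    intro n hn
    refine growth hκc hκpos hS (hvn n) (gn n) (hg n) (env F L) m1 (fun y => le_env F hn y) z ht a'
      fun s hs hst => ?_
    have q1 := d1 s hs (lt_of_le_of_lt hst (htδ.trans_le (min_le_left _ _))) z
      (hz.trans_le (min_le_left _ _))
    have q2 := d2 s hs (lt_of_le_of_lt hst (htδ.trans_le (min_le_right _ _))) z
      (hz.trans_le (min_le_right _ _))
    have q3 := lt_of_le_of_lt (hS.monotone s hs _ _ (memUk_ecoe hκpos (hneg n)) m2
      (fun y => le_env F2 hn y) z) q2
    rw [TT_coe hκpos hS (hneg n) hs, EReal.coe_lt_coe_iff] at q3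
    have q4 := TT_neg hκpos hS (hvn n).1 hs z
    refine lt_of_lt_of_le q1 (EReal.coe_le_coe_iff.2 ?_)
    linarith
  refine le_of_forall_pos_le_add fun ε hε => ?_
  have hl := TT_lsc hκc hκpos hS vn f hf K R (fun j _ => (hvn j).1.1) hvR hconv ht z (ε / 2)
    (by linarith)
  have hx : Tendsto (fun N => vn N z) atTop (𝓝 (f z)) := by
    have : Tendsto (fun N : ℕ => (N, z)) atTop (atTop ×ˢ 𝓝 z) :=
      tendsto_id.prodMk tendsto_const_nhds
    exact Tendsto.comp (g := fun p : ℕ × X => vn p.1 p.2) (hconv z) this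
  have hx' : ∀ᶠ N in atTop, vn N z < f z + ε / 2 := hx.eventually (gt_mem_nhds (by linarith))
  obtain ⟨N, h1, h2, h3⟩ := (hl.and (hx'.and (eventually_ge_atTop L))).exists
  have := key N h3
  linarith

end helper4

section helper5

variable {X : Type*} [NormedAddCommGroup X] {κ : X → ℝ} {S : ℝ → (X → EReal) → (X → EReal)}

lemma claim2 (hκc : Continuous κ) (hκpos : ∀ x, 0 < κ x) (hS : AssumptionS κ S)
    (f : X → ℝ) (hf : MemCk κ f) (fn : ℕ → X → ℝ) (g : ℕ → X → EReal)
    (hD : ∀ n, UpperLip κ S (fn n) ∧ IsGammaDeriv S (fn n) (g n))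
    (J : ∀ ε > (0:ℝ), ∃ N : ℕ, ∃ t₀ > (0:ℝ), ∀ n, N ≤ n → ∀ h, 0 < h → h ≤ t₀ → ∀ z : X, ∀ a : ℝ,
      (∀ y : X, ‖y‖ ≤ 1 / (n:ℝ) → TT S h f (z - y) ≤ f (z - y) + a * h) →
      TT S h (fn n) z ≤ fn n z + (a + ε / κ z) * h)
    (q : ℕ → ℝ) (hq0 : ∀ k, 0 < q k) (hq : Tendsto q atTop (𝓝 0))
    (x : X) (a a' : ℝ) (haa : a < a')
    (ha : ∀ᶠ p in (atTop : Filter ℕ) ×ˢ 𝓝 x, diffQuot S f (q p.1) p.2 ≤ (a : EReal)) :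
    ∀ᶠ p in (atTop : Filter ℕ) ×ˢ 𝓝 x, g p.1 p.2 ≤ (a' : EReal) := by
  obtain ⟨N, t₀, ht₀, hJ⟩ := J ((a' - a) * (κ x / 2))
    (mul_pos (by linarith) (half_pos (hκpos x)))
  obtain ⟨pa, hpa, pb, hpb, hab⟩ := eventually_prod_iff.1 ha
  have hκx : ∀ᶠ y in 𝓝 x, κ x / 2 < κ y :=
    continuousAt_const.eventually_lt hκc.continuousAt (half_lt_self (hκpos x))
  obtain ⟨δ, hδ, hball⟩ := Metric.eventually_nhds_iff.1 (hpb.and hκx)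
  have hn1 : ∀ᶠ n : ℕ in atTop, 1 / (n:ℝ) < δ / 2 :=
    tendsto_one_div_atTop_nhds_zero_nat.eventually (gt_mem_nhds (half_pos hδ))
  have hb : ∀ᶠ y in 𝓝 x, dist y x < δ / 2 := Metric.ball_mem_nhds x (half_pos hδ)
  refine ((hn1.and (eventually_ge_atTop N)).prod_mk hb).mono ?_
  rintro ⟨n, y⟩ ⟨⟨hn, hnN⟩, hy⟩
  simp only at hn hnN hy ⊢
  obtain ⟨u, hu, hut⟩ := ((hD n).2 q hq0 hq y).2
  refine le_of_tendsto hut ?_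
  have hu2 : ∀ᶠ k in atTop, dist (u k) x < δ / 2 := by
    have : ∀ᶠ w in 𝓝 y, dist w x < δ / 2 :=
      (continuous_id.dist continuous_const).continuousAt.eventually_lt continuousAt_const hy
    exact hu.eventually this
  filter_upwards [hpa, hu2, hq.eventually (gt_mem_nhds ht₀)] with k hk1 hk2 hk3
  rw [diffQuot_le_iff hκpos hS (hD n).1.1 (hq0 k)]
  have h1 := hJ n hnN (q k) (hq0 k) hk3.le (u k) a ?_
  · refine h1.trans ?_
    have h2 : κ x / 2 < κ (u k) := (hball (by linarith)).2
    have h3 : (a' - a) * (κ x / 2) / κ (u k) ≤ a' - a := by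
      rw [div_le_iff₀ (hκpos _)]
      exact mul_le_mul_of_nonneg_left h2.le (by linarith)
    have := mul_le_mul_of_nonneg_right (show a + (a' - a) * (κ x / 2) / κ (u k) ≤ a' by linarith)
      (hq0 k).le
    linarith
  · intro w hw
    rw [← diffQuot_le_iff hκpos hS hf (hq0 k)]
    refine hab hk1 (hball ?_).1
    have h4 : dist (u k - w) x ≤ dist (u k) x + ‖w‖ := by
      rw [dist_eq_norm, dist_eq_norm]
      have : u k - w - x = (u k - x) - w := by abel
      rw [this]; exact norm_sub_le _ _
    linarith

end helper5

/-- convergence in the second coordinate is unaffected by reindexing along `φ` -/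
lemma tendsto_reindex {X : Type*} [TopologicalSpace X] (x : X) {φ : ℕ → ℕ} (hφ : StrictMono φ) :
    Tendsto (fun p : ℕ × X => (φ p.1, p.2)) (atTop ×ˢ 𝓝 x) (atTop ×ˢ 𝓝 x) :=
  (hφ.tendsto_atTop.comp tendsto_fst).prodMk tendsto_snd


/-- the `Γ`-generator is determined via convolution approximations. -/
theorem stmt17
    {X : Type*} [NormedAddCommGroup X] [NormedSpace ℝ X] [CompleteSpace X]
    [TopologicalSpace.SeparableSpace X] [MeasurableSpace X] [BorelSpace X]
    (κ : X → ℝ) (hκc : Continuous κ) (hκpos : ∀ x, 0 < κ x) (hκbd : ∃ C, ∀ x, κ x ≤ C)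
    (hcκ : ∃ c : ℝ, ∀ x y : X, ‖y‖ ≤ 1 → κ x / κ (x - y) ≤ c)
    (μ : ℕ → Measure X) (hprob : ∀ n, IsProbabilityMeasure (μ n))
    (hsupp : ∀ n : ℕ, 1 ≤ n → μ n {y : X | 1 / (n : ℝ) < ‖y‖} = 0)
    (S : ℝ → (X → EReal) → (X → EReal)) (hS : AssumptionS κ S)
    (f : X → ℝ) (hf : UpperLip κ S f)
    (fn : ℕ → X → ℝ) (hfn : ∀ n x, econv (μ n) (ecoe f) x = ((fn n x : ℝ) : EReal))
    (g : ℕ → X → EReal)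
    (hD : ∀ n, UpperLip κ S (fn n) ∧ IsGammaDeriv S (fn n) (g n))
    (htrans : ∀ ε > (0:ℝ), ∃ δ > (0:ℝ), ∃ t₀ > (0:ℝ), ∀ t, 0 ≤ t → t ≤ t₀ →
      ∀ x : X, ‖x‖ ≤ δ → ∀ z : X,
        (S t (ecoe fun y => f (x + y)) z - S t (ecoe f) (x + z)).abs *
            ENNReal.ofReal (κ z) ≤ ENNReal.ofReal (ε * t)) :
    ∃ gf : X → EReal, IsGammaDeriv S f gf ∧ IsGammaLim g gf := by
  obtain ⟨c, hc⟩ := hcκ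
  have hc1 : 1 ≤ c := by
    have := hc 0 0 (by simp)
    rwa [sub_zero, div_self (hκpos 0).ne'] at this
  have hinv : ∀ n : ℕ, 1 ≤ n → 1 / (n:ℝ) ≤ 1 := fun n hn => by
    rw [div_le_one (by exact_mod_cast hn)]; exact_mod_cast hn
  have hae : ∀ n : ℕ, 1 ≤ n → ∀ᵐ y ∂μ n, ‖y‖ ≤ 1 / (n:ℝ) := fun n hn => by
    rw [ae_iff]; simp only [not_le]; exact hsupp n hn
  have hfnI : ∀ n : ℕ, 1 ≤ n → ∀ x, fn n x = ∫ y, f (x - y) ∂μ n := fun n hn x => by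
    haveI := hprob n
    exact conv_eq hκpos hc (μ n) ((hae n hn).mono fun y hy => hy.trans (hinv n hn)) hf.1 x _
      (hfn n x)
  obtain ⟨R, hR, hfR⟩ := hf.1.le_div hκpos
  -- uniform bound on the approximations
  have hfnR : ∀ n : ℕ, 1 ≤ n → ∀ y, |fn n y| ≤ R * c / κ y := fun n hn x => by
    haveI := hprob n
    have := conv_sub_le hκpos hc (μ n) (hinv n hn) (hae n hn) hf.1 x 0 (R * c / κ x)
      (fun y hy => by
        rw [sub_zero]
        exact (hfR _).trans (shift_bound hκpos hc hR x y (hy.trans (hinv n hn))))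
    rwa [sub_zero, ← hfnI n hn] at this
  -- continuous convergence
  have hconv : ∀ x, Tendsto (fun p : ℕ × X => fn p.1 p.2) (atTop ×ˢ 𝓝 x) (𝓝 (f x)) := by
    intro x
    rw [Metric.tendsto_nhds]
    intro ε hε
    obtain ⟨δ, hδ, hb⟩ := Metric.continuousAt_iff.1 (hf.1.1.continuousAt (x := x)) (ε / 2)
      (half_pos hε)
    have hn1 : ∀ᶠ n : ℕ in atTop, 1 / (n:ℝ) < δ / 2 :=
      tendsto_one_div_atTop_nhds_zero_nat.eventually (gt_mem_nhds (half_pos hδ))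
    have hb2 : ∀ᶠ y in 𝓝 x, dist y x < δ / 2 := Metric.ball_mem_nhds x (half_pos hδ)
    refine ((hn1.and (eventually_ge_atTop 1)).prod_mk hb2).mono ?_
    rintro ⟨n, y⟩ ⟨⟨hn, hn1⟩, hy⟩
    simp only at hn hn1 hy ⊢
    haveI := hprob n
    have := conv_sub_le hκpos hc (μ n) (hinv n hn1) (hae n hn1) hf.1 y (f x) (ε / 2)
      (fun w hw => by
        have : dist (y - w) x < δ := by
          calc dist (y - w) x ≤ dist (y - w) y + dist y x := dist_triangle _ _ _
            _ = ‖w‖ + dist y x := by rw [dist_eq_norm]; simp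
            _ < δ := by linarith
        exact (hb this).le)
    rw [← hfnI n hn1] at this
    rw [Real.dist_eq]; linarith
  -- Jensen estimate
  have J : ∀ ε > (0:ℝ), ∃ N : ℕ, ∃ t₀ > (0:ℝ), ∀ n, N ≤ n → ∀ h, 0 < h → h ≤ t₀ →
      ∀ z : X, ∀ a : ℝ,
      (∀ y : X, ‖y‖ ≤ 1 / (n:ℝ) → TT S h f (z - y) ≤ f (z - y) + a * h) →
      TT S h (fn n) z ≤ fn n z + (a + ε / κ z) * h := by
    intro ε hε
    obtain ⟨δ, hδ, t₀, ht₀, H⟩ := htrans ε hε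
    have hn1 : ∀ᶠ n : ℕ in atTop, 1 / (n:ℝ) < δ :=
      tendsto_one_div_atTop_nhds_zero_nat.eventually (gt_mem_nhds hδ)
    obtain ⟨N, hN⟩ := eventually_atTop.1 (hn1.and (eventually_ge_atTop 1))
    refine ⟨N, t₀, ht₀, fun n hn h hh hht z a ha => ?_⟩
    obtain ⟨hnδ, hn1⟩ := hN n hn
    haveI := hprob n
    refine jensen hκc hκpos hS hc (μ n) (by positivity) (hinv n hn1) (hae n hn1) hf.1 (fn n)
      (hD n).1.1 (hfnI n hn1) hh.le z _ fun y hy => ?_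
    have hm : MemCk κ (fun w => f (w - y)) :=
      memCk_of hκpos (hf.1.1.comp (continuous_id.sub continuous_const)) (R * c) fun w =>
        (hfR _).trans (shift_bound hκpos hc hR w y (hy.trans (hinv n hn1)))
    have h1 := H h hh.le hht (-y) (by rw [norm_neg]; linarith) z
    have e1 : (fun w => f (-y + w)) = fun w => f (w - y) := by
      funext w; rw [neg_add_eq_sub]
    rw [e1, neg_add_eq_sub, TT_coe hκpos hS hm hh.le, TT_coe hκpos hS hf.1 hh.le,
      ← EReal.coe_sub, EReal.abs_def, ← ENNReal.ofReal_mul (abs_nonneg _),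
      ENNReal.ofReal_le_ofReal_iff (by positivity)] at h1
    have h2 := (le_div_iff₀ (hκpos z)).2 h1
    have h3 := (le_abs_self _).trans h2
    have h4 := ha y hy
    have : (a + ε / κ z) * h = a * h + ε * h / κ z := by ring
    linarith
  -- upper bound on the generators
  obtain ⟨K, R', hR', hK1, hgR, hfnR'⟩ : ∃ K : ℕ, ∃ R' : ℝ, 0 ≤ R' ∧ 1 ≤ K ∧
      (∀ n, K ≤ n → ∀ y, g n y ≤ ((R' / κ y : ℝ) : EReal)) ∧
      (∀ n, K ≤ n → ∀ y, |fn n y| ≤ R' / κ y) := by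
    obtain ⟨N, t₀, ht₀, hJ⟩ := J 1 one_pos
    obtain ⟨h₀, hh₀, c₁, hc₁, hup⟩ := UpperLip.upper hκpos hS hf
    refine ⟨max 1 N, max (c₁ * c + 1) (R * c), le_max_of_le_left (by positivity), le_max_left _ _,
      fun n hn y => ?_, fun n hn y => (hfnR n ((le_max_left _ _).trans hn) y).trans
        (div_le_div_of_nonneg_right (le_max_right _ _) (hκpos y).le)⟩
    have hn1 := (le_max_left _ _).trans hn
    have hnN := (le_max_right _ _).trans hn
    have hqt : Tendsto (fun k : ℕ => 1 / ((k:ℝ) + 1)) atTop (𝓝 0) :=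
      tendsto_one_div_add_atTop_nhds_zero_nat
    obtain ⟨u, hu, hut⟩ := ((hD n).2 (fun k : ℕ => 1 / ((k:ℝ) + 1)) (fun k => by positivity)
      hqt y).2
    have hle : g n y ≤ (((c₁ * c + 1) / κ y : ℝ) : EReal) := by
      have hlim : Tendsto (fun k => (((c₁ * c + 1) / κ (u k) : ℝ) : EReal)) atTop
          (𝓝 (((c₁ * c + 1) / κ y : ℝ) : EReal)) := by
        refine (continuous_coe_real_ereal.tendsto _).comp ?_
        exact tendsto_const_nhds.div ((hκc.tendsto y).comp hu) (hκpos y).ne'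
      refine le_of_tendsto_of_tendsto hut hlim ?_
      filter_upwards [hqt.eventually (gt_mem_nhds ht₀), hqt.eventually (gt_mem_nhds hh₀)]
        with k hk1 hk2
      have hpos : 0 < 1 / ((k:ℝ) + 1) := by positivity
      rw [diffQuot_le_iff hκpos hS (hD n).1.1 hpos]
      have := hJ n hnN _ hpos hk1.le (u k) (c₁ * c / κ (u k)) (fun w hw => by
        refine (hup _ hpos.le hk2.le (u k - w)).trans ?_
        have := shift_bound hκpos hc hc₁ (u k) w (hw.trans (hinv n hn1))
        gcongr)
      rwa [← add_div] at this
    exact hle.trans (EReal.coe_le_coe_iff.2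
      (div_le_div_of_nonneg_right (le_max_left _ _) (hκpos y).le))
  have hlow : ∀ (x : X) (b : ℝ),
      (∀ᶠ p in (atTop : Filter ℕ) ×ˢ 𝓝 x, g p.1 p.2 ≤ (b : EReal)) →
      limsup (fun p : ℕ × X => g p.1 p.2) (atTop ×ˢ 𝓝 x) ≤ (b : EReal) :=
    fun x b hb => limsup_le_of_le (by isBoundedDefault) hb
  have hupp : ∀ (x : X) (a : ℝ),
      limsup (fun p : ℕ × X => g p.1 p.2) (atTop ×ˢ 𝓝 x) < (a : EReal) →
      ∀ᶠ p in (atTop : Filter ℕ) ×ˢ 𝓝 x, g p.1 p.2 ≤ (a : EReal) :=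
    fun x a ha => (eventually_lt_of_limsup_lt ha).mono fun p hp => hp.le
  refine ⟨fun x => limsup (fun p : ℕ × X => g p.1 p.2) (atTop ×ˢ 𝓝 x), ?_, ?_⟩
  · intro h hh0 hh x
    refine gamma_crit _ x _ ?_ ?_
    · intro a ha
      obtain ⟨a₁, ha1, ha2⟩ := EReal.lt_iff_exists_real_btwn.1 ha
      obtain ⟨δ, hδ, hT⟩ := claim1 hκc hκpos hS f hf.1 fn g (fun n => (hD n).1)
        (fun n => (hD n).2) K R' hR' hfnR' hgR hconv x a₁ a (EReal.coe_lt_coe_iff.1 ha2)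
        (hupp x a₁ ha1)
      refine ((hh.eventually (gt_mem_nhds hδ)).prod_mk (Metric.ball_mem_nhds x hδ)).mono ?_
      rintro ⟨k, z⟩ ⟨hk, hz⟩
      exact (diffQuot_le_iff hκpos hS hf.1 (hh0 k) z a).2 (hT _ (hh0 k).le hk z hz)
    · intro b hb U hU
      by_contra hcon
      rw [not_eventually] at hcon
      obtain ⟨φ, hφ, hφ2⟩ := extraction_of_frequently_atTop hcon
      obtain ⟨b', hb1, hb2⟩ := EReal.lt_iff_exists_real_btwn.1 hb
      have := claim2 hκc hκpos hS f hf.1 fn g hD J (fun k => h (φ k)) (fun k => hh0 _)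
        (hh.comp hφ.tendsto_atTop) x b b' (EReal.coe_lt_coe_iff.1 hb1) (by
          refine ((Eventually.of_forall (fun _ => trivial) :
            ∀ᶠ _ : ℕ in atTop, True).prod_mk hU).mono ?_
          rintro ⟨k, z⟩ ⟨-, hz⟩
          have := hφ2 k
          push Not at this
          exact this z hz)
      exact absurd (hlow x b' this) (not_le.2 hb2)
  · intro x
    refine gamma_crit _ x _ (fun a ha => hupp x a ha) ?_
    intro b hb U hU
    by_contra hcon
    rw [not_eventually] at hcon
    obtain ⟨φ, hφ, hφ2⟩ := extraction_of_frequently_atTop hcon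
    obtain ⟨b', hb1, hb2⟩ := EReal.lt_iff_exists_real_btwn.1 hb
    obtain ⟨b'', hb3, hb4⟩ := EReal.lt_iff_exists_real_btwn.1 hb2
    obtain ⟨δ, hδ, hT⟩ := claim1 hκc hκpos hS f hf.1 (fun k => fn (φ k)) (fun k => g (φ k))
      (fun n => (hD _).1) (fun n => (hD _).2) K R' hR'
      (fun n hn => hfnR' _ (hn.trans hφ.le_apply)) (fun n hn => hgR _ (hn.trans hφ.le_apply))
      (fun z => (hconv z).comp (tendsto_reindex z hφ)) x b b' (EReal.coe_lt_coe_iff.1 hb1) (by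
          refine ((Eventually.of_forall (fun _ => trivial) :
            ∀ᶠ _ : ℕ in atTop, True).prod_mk hU).mono ?_
          rintro ⟨k, z⟩ ⟨-, hz⟩
          have := hφ2 k
          push Not at this
          exact this z hz)
    have hqt : Tendsto (fun k : ℕ => 1 / ((k:ℝ) + 1)) atTop (𝓝 0) :=
      tendsto_one_div_add_atTop_nhds_zero_nat
    have := claim2 hκc hκpos hS f hf.1 fn g hD J (fun k : ℕ => 1 / ((k:ℝ) + 1))
      (fun k => by positivity) hqt x b' b'' (EReal.coe_lt_coe_iff.1 hb3) (by
        refine ((hqt.eventually (gt_mem_nhds hδ)).prod_mk (Metric.ball_mem_nhds x hδ)).mono ?_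
        rintro ⟨k, z⟩ ⟨hk, hz⟩
        have hpos : 0 < 1 / ((k:ℝ) + 1) := by positivity
        exact (diffQuot_le_iff hκpos hS hf.1 hpos z b').2 (hT _ hpos.le hk z hz))
    exact absurd (hlow x b'' this) (not_le.2 hb4)
end

section
/- Let X = ℝ^d and let (S(t))_{t≥0} satisfy Assumption S. Assume C_c^∞ ⊂ D(A), where A is the generator of S with respect to the mixed topology. Let (φ_n) ⊂ C_c^∞ with 0 ≤ φ_n ≤ 1 and φ_n(x) = 1 for |x| ≤ n, let f ∈ C_κ be infinitely differentiable with f ≥ 0, and set f_n := f·φ_n. Then: (i) if f ∈ L^S_+, then Γ-limsup_{n→∞} Af_n ≤ A_Γ⁺f pointwise; (ii) if (Af_n)_{n∈ℕ} is bounded above, then f ∈ D(A_Γ) and A_Γf = Γ-lim_{n→∞} Af_n. -/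
open Filter MeasureTheory Topology
open scoped ENNReal Topology

section Helpers

variable {E : Type*} [NormedAddCommGroup E]

/-- real-valued members of `U_κ` -/
def RUk (κ f : E → ℝ) : Prop := UpperSemicontinuous f ∧ ∃ r : ℝ, ∀ x, f x * κ x ≤ r

lemma RUk.mem {κ f : E → ℝ} (_hκ : ∀ x, 0 < κ x) (h : RUk κ f) : MemUk κ (ecoe f) := by
  obtain ⟨h1, r, hr⟩ := h
  refine ⟨?_, fun x => EReal.coe_lt_top _, max r 0, fun x => ?_⟩
  · exact continuous_coe_real_ereal.comp_upperSemicontinuous h1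
      (fun a b hab => EReal.coe_le_coe_iff.2 hab)
  · have : max (f x) 0 * κ x ≤ max r 0 := by
      rcases le_total (f x) 0 with h | h
      · simp [max_eq_right h]
      · rw [max_eq_left h]; exact (hr x).trans (le_max_left _ _)
    have h2 : max (ecoe f x) 0 = ((max (f x) 0 : ℝ) : EReal) := by
      simp only [ecoe]
      rcases le_total (f x) 0 with h | h
      · rw [max_eq_right h, max_eq_right (by exact_mod_cast h)]; rfl
      · rw [max_eq_left h, max_eq_left (by exact_mod_cast h)]
    rw [h2]
    exact_mod_cast this

lemma RUk.comb {κ f g : E → ℝ} (hf : RUk κ f) (hg : RUk κ g) {a b : ℝ}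
    (ha : 0 ≤ a) (hb : 0 ≤ b) : RUk κ (fun x => a * f x + b * g x) := by
  obtain ⟨f1, r, hr⟩ := hf
  obtain ⟨g1, q, hq⟩ := hg
  refine ⟨?_, a * r + b * q, fun x => ?_⟩
  · apply UpperSemicontinuous.add
    · exact (continuous_const_mul a).comp_upperSemicontinuous f1
        (fun x y h => mul_le_mul_of_nonneg_left h ha)
    · exact (continuous_const_mul b).comp_upperSemicontinuous g1
        (fun x y h => mul_le_mul_of_nonneg_left h hb)
  · nlinarith [mul_le_mul_of_nonneg_left (hr x) ha, mul_le_mul_of_nonneg_left (hq x) hb]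

lemma MemCk.ruk {κ f : E → ℝ} (hκ : ∀ x, 0 < κ x) (h : MemCk κ f) : RUk κ f := by
  obtain ⟨h1, r, hr⟩ := h
  exact ⟨h1.upperSemicontinuous, r, fun x =>
    (mul_le_mul_of_nonneg_right (le_abs_self _) (hκ x).le).trans (hr x)⟩

lemma usc_ite {p q : E → ℝ} (hp : UpperSemicontinuous p) (hq : Continuous q)
    (hpq : ∀ x, p x ≤ q x) (m : ℝ) :
    UpperSemicontinuous (fun x => if m ≤ ‖x‖ then q x else p x) := by
  intro x y hy
  by_cases h : m ≤ ‖x‖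
  · simp only [h, if_true] at hy
    filter_upwards [hq.continuousAt.eventually (gt_mem_nhds hy)] with z hz
    split_ifs
    · exact hz
    · exact (hpq z).trans_lt hz
  · simp only [h, if_false] at hy
    filter_upwards [hp x y hy, continuous_norm.continuousAt.eventually
      (gt_mem_nhds (not_le.1 h))] with z hz hz2
    simp only [not_le.2 hz2, if_false]
    exact hz

/-- the dominating functions -/
noncomputable def wf (κ : E → ℝ) (a R : ℝ) (k : ℕ) (x : E) : ℝ :=
  a * (1 / ((k : ℝ) + 1)) + (if (k : ℝ) ≤ ‖x‖ then R / κ x else 0)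

lemma wf_ruk {κ : E → ℝ} (hκc : Continuous κ) (hκ : ∀ x, 0 < κ x) (hκb : ∃ C, ∀ x, κ x ≤ C)
    {a R : ℝ} (ha : 0 ≤ a) (hR : 0 ≤ R) (k : ℕ) : RUk κ (wf κ a R k) := by
  obtain ⟨C, hC⟩ := hκb
  refine ⟨?_, a * (1 / ((k : ℝ) + 1)) * C + R, fun x => ?_⟩
  · unfold wf
    apply UpperSemicontinuous.add
    · exact continuous_const.upperSemicontinuous
    · exact usc_ite (p := fun _ => 0) continuous_const.upperSemicontinuous
        (continuous_const.div hκc fun x => (hκ x).ne') (fun x => div_nonneg hR (hκ x).le) _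
  · unfold wf
    rw [add_mul]
    apply add_le_add
    · exact mul_le_mul_of_nonneg_left (hC x) (by positivity)
    · split_ifs
      · rw [div_mul_cancel₀ _ (hκ x).ne']
      · simpa using hR

lemma wf_anti {κ : E → ℝ} (hκ : ∀ x, 0 < κ x) {a R : ℝ} (ha : 0 ≤ a) (hR : 0 ≤ R) (x : E) :
    Antitone fun k => wf κ a R k x := by
  intro i j hij
  have hij' : (i : ℝ) ≤ j := by exact_mod_cast hij
  unfold wf
  apply add_le_add
  · apply mul_le_mul_of_nonneg_left _ ha
    apply one_div_le_one_div_of_le <;> [positivity; linarith]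
  · have := hκ x
    split_ifs with h1 h2
    · exact le_rfl
    · exact absurd (hij'.trans h1) h2
    · positivity
    · exact le_rfl

lemma wf_nonneg {κ : E → ℝ} (hκ : ∀ x, 0 < κ x) {a R : ℝ} (ha : 0 ≤ a) (hR : 0 ≤ R) (k : ℕ)
    (x : E) : 0 ≤ wf κ a R k x := by
  unfold wf
  have := hκ x
  split_ifs <;> positivity

lemma wf_smul (κ : E → ℝ) (a R c : ℝ) (k : ℕ) (x : E) :
    wf κ (c * a) (c * R) k x = c * wf κ a R k x := by
  unfold wf
  split_ifs <;> ring

lemma wf_iInf {κ : E → ℝ} (hκ : ∀ x, 0 < κ x) {a R : ℝ} (ha : 0 ≤ a) (hR : 0 ≤ R) (x : E) :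
    (⨅ k, ecoe (wf κ a R k) x) = 0 := by
  have h1 : Tendsto (fun k => wf κ a R k x) atTop (𝓝 0) := by
    have : Tendsto (fun k : ℕ => a * (1 / ((k : ℝ) + 1))) atTop (𝓝 0) := by
      simpa using (tendsto_one_div_add_atTop_nhds_zero_nat (𝕜 := ℝ)).const_mul a
    refine this.congr' ?_
    filter_upwards [tendsto_natCast_atTop_atTop.eventually_gt_atTop ‖x‖] with k hk
    simp [wf, not_le.2 hk]
  have h2 : Tendsto (fun k => ecoe (wf κ a R k) x) atTop (𝓝 ((0 : ℝ) : EReal)) :=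
    (continuous_coe_real_ereal.tendsto 0).comp h1
  have h3 : Antitone fun k => ecoe (wf κ a R k) x :=
    fun i j hij => EReal.coe_le_coe_iff.2 (wf_anti hκ ha hR x hij)
  exact tendsto_nhds_unique (tendsto_atTop_iInf h3) h2

variable {κ : E → ℝ} {S : ℝ → (E → EReal) → (E → EReal)}

lemma S_near (hS : AssumptionS κ S) {t : ℝ} (ht : 0 ≤ t) {F : E → EReal} (hF : MemUk κ F)
    {x : E} {c : EReal} (hc : S t F x < c) :
    ∃ δ > (0 : ℝ), ∀ s, 0 ≤ s → |s - t| < δ → ∀ y, dist y x < δ → S s F y < c := by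
  by_contra hcon
  push Not at hcon
  choose s hs0 hst y hy hcy using fun n : ℕ => hcon (1 / ((n : ℝ) + 1)) (by positivity)
  have h0 := tendsto_one_div_add_atTop_nhds_zero_nat (𝕜 := ℝ)
  have hs : Tendsto s atTop (𝓝 t) := by
    rw [tendsto_iff_dist_tendsto_zero]
    exact squeeze_zero (fun _ => dist_nonneg) (fun n => (hst n).le) h0
  have hyx : Tendsto y atTop (𝓝 x) := by
    rw [tendsto_iff_dist_tendsto_zero]
    exact squeeze_zero (fun _ => dist_nonneg) (fun n => (hy n).le) h0
  have h1 := hS.gammaUsc t ht F hF x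
  have h2 : limsup (fun n => S (s n) F (y n)) atTop ≤ gammaLimsupAt (fun s => S s F) t x := by
    unfold gammaLimsupAt gammaLimsup
    refine le_iSup_of_le s <| le_iSup_of_le hs0 <| le_iSup_of_le hs <|
      le_iSup_of_le y <| le_iSup_of_le hyx le_rfl
  obtain ⟨n, hn⟩ := (eventually_lt_of_limsup_lt ((h2.trans h1).trans_lt hc)).exists
  exact absurd hn (not_lt.2 (hcy n))

lemma dini (hκc : Continuous κ) (hκ : ∀ x, 0 < κ x) (hκb : ∃ C, ∀ x, κ x ≤ C)
    (hS : AssumptionS κ S) {a R : ℝ} (ha : 0 ≤ a) (hR : 0 ≤ R) (T : ℝ)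
    {K : Set E} (hK : IsCompact K) {ε : ℝ} (hε : 0 < ε) :
    ∃ k : ℕ, ∀ s, 0 ≤ s → s ≤ T → ∀ x ∈ K, S s (ecoe (wf κ a R k)) x ≤ (ε : EReal) := by
  have hw := fun k => (wf_ruk hκc hκ hκb ha hR k).mem hκ
  by_contra hcon
  push Not at hcon
  choose s hs0 hsT y hy hey using hcon
  obtain ⟨⟨t, x⟩, htx, φ, hφ, hlim⟩ := (isCompact_Icc (a := (0 : ℝ)) (b := T)).prod hK
    |>.tendsto_subseq (x := fun n => (s n, y n)) (fun n => ⟨⟨hs0 n, hsT n⟩, hy n⟩)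
  have ht : 0 ≤ t := htx.1.1
  have h0 : MemUk κ (fun _ : E => (0 : EReal)) :=
    RUk.mem (f := fun _ => 0) hκ ⟨continuous_const.upperSemicontinuous, 0, by simp⟩
  have h1 := hS.contAbove t ht (fun k => ecoe (wf κ a R k)) (fun _ => 0) hw h0
    (fun x i j hij => EReal.coe_le_coe_iff.2 (wf_anti hκ ha hR x hij))
    (fun x => wf_iInf hκ ha hR x) x
  rw [hS.zero t ht] at h1
  have h2 : (⨅ n, S t (ecoe (wf κ a R n)) x) < (ε : EReal) := by
    rw [h1]; exact_mod_cast hε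
  obtain ⟨j, hj⟩ := iInf_lt_iff.1 h2
  obtain ⟨δ, hδ, hnear⟩ := S_near hS ht (hw j) hj
  have e1 := Metric.tendsto_nhds.1 hlim δ hδ
  obtain ⟨n, hn, hnj⟩ := (e1.and (hφ.tendsto_atTop.eventually_ge_atTop j)).exists
  rw [Prod.dist_eq, max_lt_iff] at hn
  have h3 := hnear (s (φ n)) (hs0 _) hn.1 (y (φ n)) hn.2
  have h4 := hS.monotone (s (φ n)) (hs0 _) _ _ (hw (φ n)) (hw j)
    (fun x => EReal.coe_le_coe_iff.2 (wf_anti hκ ha hR x hnj)) (y (φ n))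
  exact absurd (h4.trans_lt h3) (not_lt.2 (hey _).le)

lemma conv_le (hκ : ∀ x, 0 < κ x) (hS : AssumptionS κ S) {t : ℝ} (ht : 0 ≤ t)
    {F p q : E → ℝ} (hF : RUk κ F) (hp : RUk κ p) (hq : RUk κ q) {lam : ℝ} (h0 : 0 ≤ lam)
    (h1 : lam ≤ 1) (hle : ∀ y, F y ≤ lam * p y + (1 - lam) * q y) {x : E} {a b : ℝ}
    (ha : S t (ecoe p) x ≤ a) (hb : S t (ecoe q) x ≤ b) :
    S t (ecoe F) x ≤ ((lam * a + (1 - lam) * b : ℝ) : EReal) := by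
  have h1' : 0 ≤ 1 - lam := by linarith
  have e1 := hS.monotone t ht _ _ (hF.mem hκ) ((hp.comb hq h0 h1').mem hκ)
    (fun y => EReal.coe_le_coe_iff.2 (hle y)) x
  have e2 := hS.convex t ht _ _ (hp.mem hκ) (hq.mem hκ) lam h0 h1 x
  have e3 : (ecoe fun y => lam * p y + (1 - lam) * q y) =
      (fun y => (lam : EReal) * ecoe p y + ((1 - lam : ℝ) : EReal) * ecoe q y) := by
    funext y
    simp only [ecoe]
    push_cast
    rfl
  rw [e3] at e1
  refine e1.trans (e2.trans ?_)
  rw [EReal.coe_add, EReal.coe_mul, EReal.coe_mul]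
  exact add_le_add (mul_le_mul_of_nonneg_left ha (by exact_mod_cast h0))
    (mul_le_mul_of_nonneg_left hb (by exact_mod_cast h1'))

/-- uniform bound, real form -/
lemma bdd_real (hκ : ∀ x, 0 < κ x) (hS : AssumptionS κ S) {r t : ℝ} (hr : 0 ≤ r) (ht : 0 ≤ t) :
    ∃ C : ℝ, 0 ≤ C ∧ ∀ s, 0 ≤ s → s ≤ t → ∀ f : E → ℝ, MemCk κ f → CkBound κ r f → ∀ x,
      S s (ecoe f) x = (((S s (ecoe f) x).toReal : ℝ) : EReal) ∧
      |(S s (ecoe f) x).toReal| ≤ C / κ x := by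
  obtain ⟨C, hC, h⟩ := hS.bounded r t hr ht
  refine ⟨C.toReal, ENNReal.toReal_nonneg, fun s hs hst f hf hfr x => ?_⟩
  have h1 := (le_iSup (fun x => (S s (ecoe f) x).abs * ENNReal.ofReal (κ x)) x).trans
    (h s hs hst f hf hfr)
  have hpos := hκ x
  generalize S s (ecoe f) x = z at h1 ⊢
  have hk : ENNReal.ofReal (κ x) ≠ 0 := by simpa using hpos
  induction z with
  | bot => simp [ENNReal.top_mul hk, hC] at h1
  | top => simp [ENNReal.top_mul hk, hC] at h1
  | coe z =>
    refine ⟨by simp, ?_⟩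
    rw [EReal.abs_def, ← ENNReal.ofReal_mul (abs_nonneg _)] at h1
    rw [EReal.toReal_coe, le_div_iff₀ hpos]
    exact (ENNReal.ofReal_le_iff_le_toReal hC).1 h1

lemma S_real (hκ : ∀ x, 0 < κ x) (hS : AssumptionS κ S) {t : ℝ} (ht : 0 ≤ t) {f : E → ℝ}
    (hf : MemCk κ f) (x : E) : S t (ecoe f) x = (((S t (ecoe f) x).toReal : ℝ) : EReal) := by
  obtain ⟨hc, r, hr⟩ := id hf
  have hr0 : 0 ≤ r := (mul_nonneg (abs_nonneg _) (hκ 0).le).trans (hr 0)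
  obtain ⟨C, _, h⟩ := bdd_real hκ hS hr0 ht
  exact (h t ht le_rfl f hf hr x).1

lemma S_mono (hκ : ∀ x, 0 < κ x) (hS : AssumptionS κ S) {t : ℝ} (ht : 0 ≤ t) {f g : E → ℝ}
    (hf : MemCk κ f) (hg : MemCk κ g) (hfg : ∀ x, f x ≤ g x) (x : E) :
    (S t (ecoe f) x).toReal ≤ (S t (ecoe g) x).toReal := by
  have := hS.monotone t ht _ _ ((hf.ruk hκ).mem hκ) ((hg.ruk hκ).mem hκ)
    (fun x => EReal.coe_le_coe_iff.2 (hfg x)) x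
  rw [S_real hκ hS ht hf, S_real hκ hS ht hg] at this
  exact_mod_cast this

lemma S_cont (hκc : Continuous κ) (hκ : ∀ x, 0 < κ x) (hκb : ∃ C, ∀ x, κ x ≤ C)
    (hS : AssumptionS κ S) {g : E → ℝ} {gn : ℕ → E → ℝ} (hg : Continuous g)
    (hgn : ∀ n, Continuous (gn n)) {R : ℝ} (hgR : CkBound κ R g) (hgnR : ∀ n, CkBound κ R (gn n))
    (hle : ∀ n x, gn n x ≤ g x)
    (hlim : ∀ k : ℕ, ∀ ε > (0 : ℝ), ∃ n0, ∀ n, n0 ≤ n → ∀ x, ‖x‖ ≤ k → g x - gn n x ≤ ε)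
    {t : ℝ} (ht : 0 ≤ t) {K : Set E} (hK : IsCompact K) {ε : ℝ} (hε : 0 < ε) :
    ∃ n0, ∀ n, n0 ≤ n → ∀ x ∈ K,
      (S t (ecoe g) x).toReal ≤ (S t (ecoe (gn n)) x).toReal + ε := by
  have hR : 0 ≤ R := (mul_nonneg (abs_nonneg _) (hκ 0).le).trans (hgR 0)
  have hgC : MemCk κ g := ⟨hg, R, hgR⟩
  have hgnC : ∀ n, MemCk κ (gn n) := fun n => ⟨hgn n, R, hgnR n⟩
  have hg2C : MemCk κ (fun x => 2 * g x) := by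
    refine ⟨continuous_const.mul hg, 2 * R, fun x => ?_⟩
    rw [abs_mul, abs_two, mul_assoc]
    linarith [hgR x]
  obtain ⟨C, hC0, hC⟩ := bdd_real hκ hS (r := 2 * R) (by positivity) ht
  obtain ⟨m, hm, hmK⟩ : ∃ m > (0 : ℝ), ∀ x ∈ K, m ≤ κ x := by
    rcases K.eq_empty_or_nonempty with h | h
    · exact ⟨1, one_pos, by simp [h]⟩
    · obtain ⟨x, hx, hmin⟩ := hK.exists_isMinOn h hκc.continuousOn
      exact ⟨κ x, hκ x, fun y hy => hmin hy⟩
  set Q := C / m with hQ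
  have hQ0 : 0 ≤ Q := by positivity
  have hCQ : ∀ x ∈ K, C / κ x ≤ Q := fun x hx => by
    apply div_le_div_of_nonneg_left hC0 hm (hmK x hx)
  obtain ⟨lam, hl0, hl1, hlQ⟩ : ∃ lam : ℝ, 0 < lam ∧ lam ≤ 1 / 2 ∧ lam * (2 * Q) ≤ ε / 2 := by
    refine ⟨min (1 / 2) (ε / (4 * (Q + 1))), by positivity, min_le_left _ _, ?_⟩
    calc _ ≤ ε / (4 * (Q + 1)) * (2 * Q) := by gcongr; exact min_le_right _ _
      _ = ε / 2 * (Q / (Q + 1)) := by field_simp; ring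
      _ ≤ ε / 2 * 1 := by gcongr; rw [div_le_one (by positivity)]; linarith
      _ = _ := by ring
  obtain ⟨k, hk⟩ := dini hκc hκ hκb hS (a := 2 / lam * 1) (R := 2 / lam * (2 * R))
    (by positivity) (by positivity) t hK hε
  obtain ⟨n0, hn0⟩ := hlim k (1 / ((k : ℝ) + 1)) (by positivity)
  refine ⟨n0, fun n hn x hx => ?_⟩
  have hb2 := hC t ht le_rfl (gn n) (hgnC n)
    (fun y => (hgnR n y).trans (by linarith)) x
  have hb3 := hC t ht le_rfl (fun x => 2 * g x) hg2C (fun y => by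
    rw [abs_mul, abs_two, mul_assoc]
    linarith [hgR y]) x
  have hw := wf_ruk hκc hκ hκb (a := 2 / lam * 1) (R := 2 / lam * (2 * R))
    (by positivity) (by positivity) k
  have hdiff : ∀ y, g y - gn n y ≤ wf κ 1 (2 * R) k y := by
    intro y
    unfold wf
    split_ifs with h
    · have : g y - gn n y ≤ 2 * R / κ y := by
        rw [le_div_iff₀ (hκ y)]
        have a1 := hgR y
        have a2 := hgnR n y
        have a3 := mul_le_mul_of_nonneg_right (le_abs_self (g y)) (hκ y).le
        have a4 := mul_le_mul_of_nonneg_right (neg_abs_le (gn n y)) (hκ y).le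
        linarith
      have : (0 : ℝ) ≤ 1 * (1 / ((k : ℝ) + 1)) := by positivity
      linarith
    · have := hn0 n hn y (not_le.1 h).le
      linarith
  -- the auxiliary function
  have hq : RUk κ (fun y => (1 - 1 / lam) * gn n y + (1 / lam) * g y) := by
    apply MemCk.ruk hκ
    refine ⟨(continuous_const.mul (hgn n)).add (continuous_const.mul hg),
      |1 - 1 / lam| * R + |1 / lam| * R, fun y => ?_⟩
    have := abs_add_le ((1 - 1 / lam) * gn n y) ((1 / lam) * g y)
    rw [abs_mul, abs_mul] at this
    have a0 := mul_le_mul_of_nonneg_right this (hκ y).le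
    have a1 := mul_le_mul_of_nonneg_left (hgR y) (abs_nonneg (1 / lam))
    have a2 := mul_le_mul_of_nonneg_left (hgnR n y) (abs_nonneg (1 - 1 / lam))
    linarith
  have e1 := conv_le hκ hS ht (x := x) hq (hg2C.ruk hκ) hw (lam := 1 / 2) (by norm_num) (by norm_num)
    (fun y => by
      rw [wf_smul]
      have h1 := hdiff y
      have h2 := hle n y
      have h3 : 1 / lam * (g y - gn n y) ≤ 1 / lam * wf κ 1 (2 * R) k y :=
        mul_le_mul_of_nonneg_left h1 (by positivity)
      have h4 : (2 : ℝ) / lam = 2 * (1 / lam) := by ring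
      rw [h4]
      nlinarith)
    hb3.1.le (hk t ht le_rfl x hx)
  have e2 := conv_le hκ hS ht (x := x) (hgC.ruk hκ) hq ((hgnC n).ruk hκ) (lam := lam) hl0.le
    (by linarith) (fun y => by
      apply le_of_eq
      field_simp
      ring) e1 hb2.1.le
  rw [S_real hκ hS ht hgC] at e2
  have e3 := EReal.coe_le_coe_iff.1 e2
  have b2 := (abs_le.1 (hb2.2.trans (hCQ x hx)))
  have b3 := (abs_le.1 (hb3.2.trans (hCQ x hx)))
  refine e3.trans ?_
  nlinarith [mul_le_mul_of_nonneg_left b2.1 hl0.le, mul_le_mul_of_nonneg_left b3.2 hl0.le]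

lemma key_est [ProperSpace E] (hκc : Continuous κ) (hκ : ∀ x, 0 < κ x) (hκb : ∃ C, ∀ x, κ x ≤ C)
    (hS : AssumptionS κ S) {ψ A : E → ℝ} (hψ : UpperLip κ S ψ) (hA : MemCk κ A)
    (hD : MixedDeriv κ S ψ A) {h : ℝ} (hh : 0 < h) {x : E} {a b : ℝ}
    (ha : ∀ s, 0 ≤ s → s ≤ h → S s (ecoe fun y => 2 * ψ y + 2 * A y) x ≤ ((2 * a : ℝ) : EReal))
    (hb : ∀ s, 0 ≤ s → s ≤ h → b ≤ (S s (ecoe ψ) x).toReal) :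
    (S h (ecoe ψ) x).toReal ≤ ψ x + h * (a - b) := by
  obtain ⟨hψC, hψk, hψs, -⟩ := hψ
  obtain ⟨⟨h0, hh0, r, hr⟩, hloc⟩ := hD
  obtain ⟨hAc, r', hr'⟩ := id hA
  have hr'0 : 0 ≤ r' := (mul_nonneg (abs_nonneg _) (hκ 0).le).trans (hr' 0)
  have hr0 : 0 ≤ r := (mul_nonneg (abs_nonneg _) (hκ 0).le).trans (hr h0 hh0 le_rfl 0)
  apply le_of_forall_pos_le_add
  intro ε' hε'
  obtain ⟨ε, hε, hεε⟩ : ∃ ε > 0, h * ε = ε' := ⟨ε' / h, by positivity, by field_simp⟩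
  obtain ⟨k, hk⟩ := dini hκc hκ hκb hS (a := 2 * 1) (R := 2 * (r + r')) (by positivity)
    (by positivity) h (isCompact_singleton (x := x)) (ε := 2 * ε) (by positivity)
  have hw := wf_ruk hκc hκ hκb (a := 2 * 1) (R := 2 * (r + r')) (by positivity)
    (by positivity) k
  obtain ⟨h1, hh1, hloc1⟩ := hloc (Metric.closedBall 0 k) (isCompact_closedBall 0 _)
    (1 / ((k : ℝ) + 1)) (by positivity)
  obtain ⟨N, hN⟩ := exists_nat_gt (h / min (min h0 h1) 1)
  have hmin : 0 < min (min h0 h1) 1 := by positivity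
  have hNpos : (0 : ℝ) < N := lt_of_le_of_lt (by positivity) hN
  obtain ⟨τ, hτ⟩ : ∃ τ : ℝ, τ = h / N := ⟨_, rfl⟩
  have hτ0 : 0 < τ := by rw [hτ]; positivity
  have hτm : τ ≤ min (min h0 h1) 1 := by
    rw [hτ, div_le_iff₀ hNpos]
    rw [div_lt_iff₀ hmin] at hN
    linarith
  have hτN : N * τ = h := by rw [hτ]; field_simp
  have hτh0 : τ ≤ h0 := hτm.trans ((min_le_left _ _).trans (min_le_left _ _))
  have hτh1 : τ ≤ h1 := hτm.trans ((min_le_left _ _).trans (min_le_right _ _))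
  have hτ1 : τ ≤ 1 := hτm.trans (min_le_right _ _)
  -- the difference quotient
  obtain ⟨G, hG, hGe⟩ := hψk τ hτ0.le
  have hSG : S τ (ecoe ψ) = ecoe G := funext hGe
  have hGr : ∀ y, (S τ (ecoe ψ) y).toReal = G y := fun y => by rw [hGe, EReal.toReal_coe]
  set D : E → ℝ := fun y => τ⁻¹ * (G y - ψ y) with hDdef
  have hDle : ∀ y, D y ≤ A y + wf κ 1 (r + r') k y := by
    intro y
    unfold wf
    split_ifs with hy
    · have a1 := hr τ hτ0 hτh0 y
      have a2 := hr' y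
      rw [hGr] at a1
      have a3 := mul_le_mul_of_nonneg_right (le_abs_self (D y)) (hκ y).le
      have a4 := mul_le_mul_of_nonneg_right (neg_abs_le (A y)) (hκ y).le
      have : D y - A y ≤ (r + r') / κ y := by
        rw [le_div_iff₀ (hκ y)]
        linarith
      have : (0 : ℝ) ≤ 1 * (1 / ((k : ℝ) + 1)) := by positivity
      linarith
    · have := hloc1 τ hτ0 hτh1 y (by simpa using (not_le.1 hy).le)
      rw [hGr] at this
      have := (abs_le.1 this).2
      simp only [hDdef]
      linarith
  have hψA : RUk κ (fun y => 2 * ψ y + 2 * A y) :=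
    (hψC.ruk hκ).comb (hA.ruk hκ) (by norm_num) (by norm_num)
  have hψD : RUk κ (fun y => ψ y + D y) := by
    refine ⟨(hψC.1.add (continuous_const.mul (hG.1.sub hψC.1))).upperSemicontinuous, ?_⟩
    obtain ⟨-, q, hq⟩ := hψC
    refine ⟨q + r, fun y => ?_⟩
    have a1 := hr τ hτ0 hτh0 y
    rw [hGr] at a1
    have a3 := mul_le_mul_of_nonneg_right (le_abs_self (D y)) (hκ y).le
    have a4 := mul_le_mul_of_nonneg_right (le_abs_self (ψ y)) (hκ y).le
    have := hq y
    simp only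
    linarith
  have claim : ∀ i : ℕ, i ≤ N →
      (S (i * τ) (ecoe ψ) x).toReal ≤ ψ x + i * τ * (a + ε - b) := by
    intro i
    induction i with
    | zero =>
      intro _
      rw [Nat.cast_zero, zero_mul, hS.idZero _ ((hψC.ruk hκ).mem hκ)]
      simp [ecoe]
    | succ i ih =>
      intro hi
      have ih' := ih (by omega)
      have hit : 0 ≤ (i : ℝ) * τ := by positivity
      have hith : (i : ℝ) * τ ≤ h := by
        rw [← hτN]
        have : (i : ℝ) ≤ N := by exact_mod_cast (by omega : i ≤ N)
        gcongr
      have e1 := conv_le hκ hS hit (x := x) hψD hψA hw (lam := 1 / 2) (by norm_num) (by norm_num)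
        (fun y => by
          rw [wf_smul]
          have := hDle y
          linarith) (ha _ hit hith) (hk _ hit hith x rfl)
      have e2 := conv_le hκ hS hit (x := x) (hG.ruk hκ) hψD (hψC.ruk hκ) (lam := τ) hτ0.le hτ1
        (fun y => by
          apply le_of_eq
          simp only [hDdef]
          field_simp
          ring) e1 (S_real hκ hS hit hψC x).le
      have e3 : S (((i + 1 : ℕ) : ℝ) * τ) (ecoe ψ) x = S (i * τ) (ecoe G) x := by
        rw [← hSG, ← hψs _ _ hit hτ0.le]
        congr 2
        push_cast
        ring
      rw [e3]
      rw [S_real hκ hS hit hG] at e2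
      have e4 := EReal.coe_le_coe_iff.1 e2
      have e5 := mul_le_mul_of_nonneg_left (hb _ hit hith) hτ0.le
      push_cast
      linarith
  have := claim N le_rfl
  rw [hτN] at this
  rw [← hεε]
  linarith

/-- a diagonal argument producing recovery sequences -/
lemma recovery {F : ℕ → E → EReal} {L : ℝ} {x : E}
    (h : ∀ ε > (0 : ℝ), ∃ y, dist y x < ε ∧ ∀ᶠ k in atTop, ((L - ε : ℝ) : EReal) ≤ F k y) :
    ∃ u : ℕ → E, Tendsto u atTop (𝓝 x) ∧ (L : EReal) ≤ liminf (fun k => F k (u k)) atTop := by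
  classical
  let e : ℕ → ℝ := fun j => 1 / ((j : ℝ) + 1)
  have he : ∀ j, 0 < e j := fun j => by positivity
  have he0 : Tendsto e atTop (𝓝 0) := tendsto_one_div_add_atTop_nhds_zero_nat
  have hanti : ∀ i j, i ≤ j → e j ≤ e i := fun i j hij => by
    apply one_div_le_one_div_of_le
    · positivity
    · have : (i : ℝ) ≤ j := by exact_mod_cast hij
      linarith
  let P : ℕ → ℕ → E → Prop := fun j k y => dist y x < e j ∧ ((L - e j : ℝ) : EReal) ≤ F k y
  let J : ℕ → ℕ := fun k => Nat.findGreatest (fun j => ∃ y, P j k y) k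
  let u : ℕ → E := fun k => if hk : ∃ y, P (J k) k y then hk.choose else x
  have hu : ∀ j, ∀ᶠ k in atTop, P j k (u k) := by
    intro j
    obtain ⟨y, hy, hyk⟩ := h (e j) (he j)
    filter_upwards [hyk, eventually_ge_atTop j] with k hk hjk
    have hex : ∃ y, P j k y := ⟨y, hy, hk⟩
    have h1 : j ≤ J k := Nat.le_findGreatest hjk hex
    have h2 : ∃ y, P (J k) k y := Nat.findGreatest_spec (P := fun j => ∃ y, P j k y) hjk hex
    have h3 : P (J k) k (u k) := by
      simp only [u, dif_pos h2]
      exact h2.choose_spec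
    have h4 := hanti _ _ h1
    exact ⟨h3.1.trans_le h4, le_trans (EReal.coe_le_coe_iff.2 (by linarith)) h3.2⟩
  refine ⟨u, ?_, ?_⟩
  · rw [Metric.tendsto_nhds]
    intro ε hε
    obtain ⟨j, hj⟩ := (he0.eventually (gt_mem_nhds hε)).exists
    filter_upwards [hu j] with k hk
    exact hk.1.trans hj
  · have h1 : ∀ j, ((L - e j : ℝ) : EReal) ≤ liminf (fun k => F k (u k)) atTop := fun j =>
      le_liminf_of_le (by isBoundedDefault) ((hu j).mono fun k hk => hk.2)
    have h2 : Tendsto (fun j => ((L - e j : ℝ) : EReal)) atTop (𝓝 (L : EReal)) := by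
      refine (continuous_coe_real_ereal.tendsto L).comp ?_
      simpa using he0.const_sub L
    exact le_of_tendsto' h2 h1

lemma deriv_mono (hκ : ∀ x, 0 < κ x) (hS : AssumptionS κ S) {p q A B : E → ℝ}
    (hp : MemCk κ p) (hq : MemCk κ q) (hpq : ∀ x, p x ≤ q x)
    (hA : MixedDeriv κ S p A) (hB : MixedDeriv κ S q B) {y : E} (hy : p y = q y) :
    A y ≤ B y := by
  apply le_of_forall_pos_le_add
  intro ε hε
  obtain ⟨h1, hh1, H1⟩ := hA.2 {y} isCompact_singleton (ε / 2) (by positivity)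
  obtain ⟨h2, hh2, H2⟩ := hB.2 {y} isCompact_singleton (ε / 2) (by positivity)
  have hm : 0 < min h1 h2 := lt_min hh1 hh2
  have a1 := (abs_le.1 (H1 _ hm (min_le_left _ _) y rfl)).1
  have a2 := (abs_le.1 (H2 _ hm (min_le_right _ _) y rfl)).2
  have a3 := S_mono hκ hS hm.le hp hq hpq y
  have a4 : (min h1 h2)⁻¹ * ((S (min h1 h2) (ecoe p) y).toReal - p y) ≤
      (min h1 h2)⁻¹ * ((S (min h1 h2) (ecoe q) y).toReal - q y) := by
    apply mul_le_mul_of_nonneg_left _ (by positivity)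
    linarith
  linarith

lemma upperLip_of_bdd [ProperSpace E] (hκc : Continuous κ) (hκ : ∀ x, 0 < κ x)
    (hκb : ∃ C, ∀ x, κ x ≤ C) (hS : AssumptionS κ S) {f : E → ℝ} {fn A : ℕ → E → ℝ}
    (hf : MemCk κ f) (hfn : ∀ n, UpperLip κ S (fn n)) (h0 : ∀ n x, 0 ≤ fn n x)
    (hle : ∀ n x, fn n x ≤ f x) (heq : ∀ (n : ℕ) x, ‖x‖ ≤ n → fn n x = f x)
    (hA : ∀ n, MemCk κ (A n)) (hD : ∀ n, MixedDeriv κ S (fn n) (A n))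
    {r : ℝ} (hr : ∀ n x, max (A n x) 0 * κ x ≤ r) :
    UpperLip κ S f := by
  obtain ⟨hfc, R, hR⟩ := id hf
  have hR0 : 0 ≤ R := (mul_nonneg (abs_nonneg _) (hκ 0).le).trans (hR 0)
  have hr0 : 0 ≤ r := (mul_nonneg (le_max_right _ _) (hκ 0).le).trans (hr 0 0)
  have hf0 : ∀ x, 0 ≤ f x := fun x => (h0 0 x).trans (hle 0 x)
  have hfnR : ∀ n, CkBound κ R (fn n) := fun n x => by
    rw [abs_of_nonneg (h0 n x)]
    have := hR x
    rw [abs_of_nonneg (hf0 x)] at this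
    exact (mul_le_mul_of_nonneg_right (hle n x) (hκ x).le).trans this
  have hfnC : ∀ n, MemCk κ (fn n) := fun n => (hfn n).1
  have hcont : ∀ {t : ℝ}, 0 ≤ t → ∀ {K : Set E}, IsCompact K → ∀ {ε : ℝ}, 0 < ε →
      ∃ n0, ∀ n, n0 ≤ n → ∀ x ∈ K,
      (S t (ecoe f) x).toReal ≤ (S t (ecoe (fn n)) x).toReal + ε := by
    intro t ht K hK ε hε
    refine S_cont hκc hκ hκb hS hfc (fun n => (hfnC n).1) hR hfnR hle ?_ ht hK hε
    intro k ε hε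
    refine ⟨k, fun n hn x hx => ?_⟩
    rw [heq n x (hx.trans (by exact_mod_cast hn)), sub_self]
    exact hε.le
  have hCk : ∀ t, 0 ≤ t → MemCk κ (fun x => (S t (ecoe f) x).toReal) := by
    intro t ht
    constructor
    · have : TendstoLocallyUniformly (fun n x => (S t (ecoe (fn n)) x).toReal)
          (fun x => (S t (ecoe f) x).toReal) atTop := by
        rw [tendstoLocallyUniformly_iff_forall_isCompact]
        intro K hK
        rw [Metric.tendstoUniformlyOn_iff]
        intro ε hε
        obtain ⟨n0, hn0⟩ := hcont ht hK (half_pos hε)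
        filter_upwards [eventually_ge_atTop n0] with n hn x hx
        have a1 := hn0 n hn x hx
        have a2 := S_mono hκ hS ht (hfnC n) hf (hle n) x
        rw [Real.dist_eq, abs_lt]
        constructor <;> linarith
      apply this.continuous
      refine Eventually.frequently (Eventually.of_forall fun n => ?_)
      obtain ⟨g, hg, hge⟩ := (hfn n).2.1 t ht
      have : (fun x => (S t (ecoe (fn n)) x).toReal) = g := by
        funext x
        rw [hge, EReal.toReal_coe]
      rw [this]
      exact hg.1
    · obtain ⟨C, hC0, hC⟩ := bdd_real hκ hS hR0 ht
      refine ⟨C, fun x => ?_⟩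
      rw [← le_div_iff₀ (hκ x)]
      exact (hC t ht le_rfl f hf hR x).2
  refine ⟨hf, fun t ht => ⟨_, hCk t ht, fun x => S_real hκ hS ht hf x⟩, ?_, ?_⟩
  · intro s t hs ht
    funext x
    have hst : 0 ≤ s + t := by positivity
    set g : E → ℝ := fun x => (S t (ecoe f) x).toReal with hg
    set gn : ℕ → E → ℝ := fun n x => (S t (ecoe (fn n)) x).toReal with hgn
    have e1 : S t (ecoe f) = ecoe g := funext fun x => S_real hκ hS ht hf x
    have e2 : ∀ n, S t (ecoe (fn n)) = ecoe (gn n) :=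
      fun n => funext fun x => S_real hκ hS ht (hfnC n) x
    obtain ⟨C, hC0, hC⟩ := bdd_real hκ hS hR0 ht
    have gR : CkBound κ C g := fun x => by
      rw [← le_div_iff₀ (hκ x)]
      exact (hC t ht le_rfl f hf hR x).2
    have gnR : ∀ n, CkBound κ C (gn n) := fun n x => by
      rw [← le_div_iff₀ (hκ x)]
      exact (hC t ht le_rfl (fn n) (hfnC n) (hfnR n) x).2
    have gnc : ∀ n, Continuous (gn n) := fun n => by
      obtain ⟨g', hg', hge⟩ := (hfn n).2.1 t ht
      have : gn n = g' := by
        funext x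
        simp only [hgn]
        rw [hge, EReal.toReal_coe]
      rw [this]
      exact hg'.1
    have gle : ∀ n x, gn n x ≤ g x := fun n x => S_mono hκ hS ht (hfnC n) hf (hle n) x
    rw [e1, S_real hκ hS hst hf, S_real hκ hS hs (hCk t ht)]
    have hmid : ∀ n, (S (s + t) (ecoe (fn n)) x).toReal = (S s (ecoe (gn n)) x).toReal :=
      fun n => by rw [(hfn n).2.2.1 s t hs ht, e2]
    congr 1
    apply le_antisymm
    · apply le_of_forall_pos_le_add
      intro ε hε
      obtain ⟨n0, hn0⟩ := hcont hst (isCompact_singleton (x := x)) hε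
      have a1 := hn0 n0 le_rfl x rfl
      have a2 := S_mono hκ hS hs ⟨gnc n0, C, gnR n0⟩ (hCk t ht) (gle n0) x
      rw [hmid] at a1
      linarith
    · apply le_of_forall_pos_le_add
      intro ε hε
      obtain ⟨n0, hn0⟩ := S_cont hκc hκ hκb hS (hCk t ht).1 gnc gR gnR gle
        (fun k ε hε => by
          obtain ⟨n0, hn0⟩ := hcont ht (isCompact_closedBall (0 : E) k) hε
          refine ⟨n0, fun n hn x hx => ?_⟩
          have := hn0 n hn x (by simpa using hx)
          simp only [hgn]
          linarith) hs (isCompact_singleton (x := x)) hε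
      have a1 := hn0 n0 le_rfl x rfl
      have a2 := S_mono hκ hS hst (hfnC n0) hf (hle n0) x
      rw [← hmid] at a1
      linarith
  · -- upper Lipschitz estimate
    set v : E → ℝ := fun x => 2 * f x + 2 * (r / κ x) with hv
    have hvc : Continuous v := (continuous_const.mul hfc).add
      (continuous_const.mul (continuous_const.div hκc fun x => (hκ x).ne'))
    have hvR : CkBound κ (2 * R + 2 * r) v := fun x => by
      have h1 : 0 ≤ r / κ x := div_nonneg hr0 (hκ x).le
      have h2 := hf0 x
      have h3 := hR x
      rw [abs_of_nonneg h2] at h3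
      rw [abs_of_nonneg (by simp only [hv]; positivity)]
      simp only [hv]
      have : r / κ x * κ x = r := div_mul_cancel₀ _ (hκ x).ne'
      nlinarith
    have hvC : MemCk κ v := ⟨hvc, _, hvR⟩
    obtain ⟨C, hC0, hC⟩ := bdd_real hκ hS (r := 2 * R + 2 * r) (t := 1) (by positivity) zero_le_one
    have main : ∀ h, 0 < h → h ≤ 1 → ∀ x,
        (S h (ecoe f) x).toReal ≤ f x + h * (C / 2 / κ x) := by
      intro h hh hh1 x
      apply le_of_forall_pos_le_add
      intro ε hε
      obtain ⟨n0, hn0⟩ := hcont hh.le (isCompact_singleton (x := x)) hε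
      obtain ⟨n1, hn1⟩ := exists_nat_ge ‖x‖
      set n := max n0 n1 with hn
      have a1 := hn0 n (le_max_left _ _) x rfl
      have a2 : fn n x = f x := heq n x (hn1.trans (by exact_mod_cast le_max_right _ _))
      have a3 := key_est hκc hκ hκb hS (hfn n) (hA n) (hD n) hh (x := x) (a := C / 2 / κ x)
        (b := 0) (fun s hs hsh => by
          have b1 := hS.monotone s hs _ _ (RUk.mem hκ
            (((hfnC n).ruk hκ).comb ((hA n).ruk hκ) (a := 2) (b := 2) (by norm_num) (by norm_num)))
            ((hvC.ruk hκ).mem hκ)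
            (fun y => by
              apply EReal.coe_le_coe_iff.2
              have c1 := hle n y
              have c2 : A n y ≤ r / κ y := by
                rw [le_div_iff₀ (hκ y)]
                exact (mul_le_mul_of_nonneg_right (le_max_left _ _) (hκ y).le).trans (hr n y)
              simp only [hv]
              linarith) x
          refine b1.trans ?_
          have b2 := hC s hs (hsh.trans hh1) v hvC hvR x
          rw [b2.1]
          apply EReal.coe_le_coe_iff.2
          refine (le_abs_self _).trans (b2.2.trans (le_of_eq ?_))
          ring)
        (fun s hs hsh => by
          have b1 := hS.monotone s hs (fun _ => 0) (ecoe (fn n))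
            (RUk.mem (f := fun _ => 0) hκ ⟨continuous_const.upperSemicontinuous, 0, by simp⟩)
            (((hfnC n).ruk hκ).mem hκ) (fun y => EReal.coe_le_coe_iff.2 (h0 n y)) x
          rw [hS.zero s hs, S_real hκ hS hs (hfnC n)] at b1
          exact_mod_cast b1)
      rw [a2] at a3
      linarith
    refine ⟨1, one_pos, C / 2, by positivity, fun h hh hh1 x => ?_⟩
    have hkey : (S h (ecoe f) x).toReal - f x ≤ h * (C / 2 / κ x) := by
      rcases hh.eq_or_lt with h' | h'
      · rw [← h', hS.idZero _ ((hf.ruk hκ).mem hκ)]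
        simp [ecoe]
      · linarith [main h h' hh1 x]
    rw [S_real hκ hS hh hf, ← EReal.coe_sub, ← EReal.coe_zero, ← EReal.coe_strictMono.monotone.map_max,
      ← EReal.coe_mul, EReal.coe_le_coe_iff]
    have hpos : 0 ≤ h * (C / 2 / κ x) := by have := hκ x; positivity
    calc _ ≤ h * (C / 2 / κ x) * κ x := by
          apply mul_le_mul_of_nonneg_right _ (hκ x).le
          exact max_le hkey hpos
      _ = C / 2 * h := by have := (hκ x).ne'; field_simp

lemma dq_real (hκ : ∀ x, 0 < κ x) (hS : AssumptionS κ S) {h : ℝ} (hh : 0 ≤ h) {f : E → ℝ}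
    (hf : MemCk κ f) (x : E) :
    diffQuot S f h x = ((h⁻¹ * ((S h (ecoe f) x).toReal - f x) : ℝ) : EReal) := by
  unfold diffQuot
  rw [EReal.coe_mul, EReal.coe_sub, ← S_real hκ hS hh hf]

lemma part_one (hκ : ∀ x, 0 < κ x) (hS : AssumptionS κ S) {f : E → ℝ} {fn A : ℕ → E → ℝ}
    (hf : MemCk κ f) (hfn : ∀ n, MemCk κ (fn n))
    (hle : ∀ n x, fn n x ≤ f x) (heq : ∀ (n : ℕ) x, ‖x‖ ≤ n → fn n x = f x)
    (hD : ∀ n, MixedDeriv κ S (fn n) (A n)) (x : E) :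
    gammaLimsup (fun n => ecoe (A n)) x ≤ uppGen S f x := by
  refine iSup₂_le fun u hu => ?_
  have hh : ∀ n : ℕ, ∃ h : ℝ, 0 < h ∧ h ≤ 1 / ((n : ℝ) + 1) ∧
      |h⁻¹ * ((S h (ecoe (fn n)) (u n)).toReal - fn n (u n)) - A n (u n)| ≤
        1 / ((n : ℝ) + 1) := by
    intro n
    obtain ⟨h0, hh0, H⟩ := (hD n).2 {u n} isCompact_singleton (1 / ((n : ℝ) + 1)) (by positivity)
    exact ⟨min h0 (1 / ((n : ℝ) + 1)), by positivity, min_le_right _ _,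
      H _ (by positivity) (min_le_left _ _) _ rfl⟩
  choose h hh0 hh1 hhA using hh
  have he0 := tendsto_one_div_add_atTop_nhds_zero_nat (𝕜 := ℝ)
  have hh : Tendsto h atTop (𝓝 0) := squeeze_zero (fun n => (hh0 n).le) hh1 he0
  have hub : limsup (fun n => diffQuot S f (h n) (u n)) atTop ≤ uppGen S f x := by
    unfold uppGen gammaLimsupZero gammaLimsup
    refine le_iSup_of_le h <| le_iSup_of_le hh0 <| le_iSup_of_le hh <|
      le_iSup_of_le u <| le_iSup_of_le hu le_rfl
  apply le_of_forall_gt_imp_ge_of_dense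
  intro c hc
  obtain ⟨c1, hc1, hc1'⟩ := EReal.lt_iff_exists_real_btwn.1 hc
  obtain ⟨c2, hc2, hc2'⟩ := EReal.lt_iff_exists_real_btwn.1 hc1'
  have hcc : 0 < c2 - c1 := by
    have := EReal.coe_lt_coe_iff.1 hc2
    linarith
  apply limsup_le_of_le (by isBoundedDefault)
  have hnorm : ∀ᶠ n : ℕ in atTop, ‖u n‖ ≤ n := by
    filter_upwards [hu.norm.eventually (gt_mem_nhds (lt_add_one ‖x‖)),
      tendsto_natCast_atTop_atTop.eventually_ge_atTop (‖x‖ + 1)] with n h1 h2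
    exact h1.le.trans h2
  filter_upwards [eventually_lt_of_limsup_lt (hub.trans_lt hc1),
    he0.eventually (gt_mem_nhds hcc), hnorm] with n h1 h2 h3
  refine le_trans ?_ hc2'.le
  apply EReal.coe_le_coe_iff.2
  rw [dq_real hκ hS (hh0 n).le hf, EReal.coe_lt_coe_iff] at h1
  have a1 := (abs_le.1 (hhA n)).1
  have a2 := S_mono hκ hS (hh0 n).le (hfn n) hf (hle n) (u n)
  rw [heq n _ h3] at a1
  have a3 : (h n)⁻¹ * ((S (h n) (ecoe (fn n)) (u n)).toReal - f (u n)) ≤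
      (h n)⁻¹ * ((S (h n) (ecoe f) (u n)).toReal - f (u n)) := by
    apply mul_le_mul_of_nonneg_left _ (by have := hh0 n; positivity)
    linarith
  linarith

lemma part_two [ProperSpace E] (hκc : Continuous κ) (hκ : ∀ x, 0 < κ x)
    (hκb : ∃ C, ∀ x, κ x ≤ C) (hS : AssumptionS κ S) {f : E → ℝ} {fn A : ℕ → E → ℝ}
    (hf : MemCk κ f) (hfn : ∀ n, UpperLip κ S (fn n)) (h0 : ∀ n x, 0 ≤ fn n x)
    (hle : ∀ n x, fn n x ≤ f x) (heq : ∀ (n : ℕ) x, ‖x‖ ≤ n → fn n x = f x)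
    (hM : ∀ n, ∃ M : ℕ, ∀ p, M ≤ p → ∀ x, fn n x ≤ fn p x)
    (hA : ∀ n, MemCk κ (A n)) (hD : ∀ n, MixedDeriv κ S (fn n) (A n))
    {r : ℝ} (hr : ∀ n x, max (A n x) 0 * κ x ≤ r) :
    ∃ gf : E → EReal, IsGammaDeriv S f gf ∧ IsGammaLim (fun n => ecoe (A n)) gf := by
  obtain ⟨hfc, R, hR⟩ := id hf
  have hf0 : ∀ x, 0 ≤ f x := fun x => (h0 0 x).trans (hle 0 x)
  have hfnC : ∀ n, MemCk κ (fn n) := fun n => (hfn n).1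
  have hfnR : ∀ n, CkBound κ R (fn n) := fun n x => by
    rw [abs_of_nonneg (h0 n x)]
    have := hR x
    rw [abs_of_nonneg (hf0 x)] at this
    exact (mul_le_mul_of_nonneg_right (hle n x) (hκ x).le).trans this
  have hAr : ∀ n y, A n y ≤ r / κ y := fun n y => by
    rw [le_div_iff₀ (hκ y)]
    exact (mul_le_mul_of_nonneg_right (le_max_left _ _) (hκ y).le).trans (hr n y)
  have hrκ : Continuous fun y => r / κ y := continuous_const.div hκc fun x => (hκ x).ne'
  let G : E → EReal := fun x => ⨆ (n : ℕ) (_ : ‖x‖ ≤ n), (A n x : EReal)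
  let Gsup : E → EReal := fun x => limsup G (𝓝 x)
  have hAG : ∀ (n : ℕ) x, ‖x‖ ≤ n → (A n x : EReal) ≤ G x := fun n x hn =>
    le_iSup₂ (f := fun (n : ℕ) (_ : ‖x‖ ≤ n) => (A n x : EReal)) n hn
  have hGr : ∀ x, G x ≤ ((r / κ x : ℝ) : EReal) := fun x =>
    iSup₂_le fun n _ => EReal.coe_le_coe_iff.2 (hAr n x)
  have hGGL : ∀ x, G x ≤ Gsup x := fun x => by
    apply le_limsup_of_frequently_le _ (by isBoundedDefault)
    intro hcon
    exact hcon.self_of_nhds le_rfl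
  have hGLr : ∀ x, Gsup x ≤ ((r / κ x : ℝ) : EReal) := fun x => by
    have h1 : Tendsto (fun y => ((r / κ y : ℝ) : EReal)) (𝓝 x) (𝓝 ((r / κ x : ℝ) : EReal)) :=
      (continuous_coe_real_ereal.comp hrκ).tendsto x
    rw [← h1.limsup_eq]
    exact limsup_le_limsup (Eventually.of_forall hGr) (by isBoundedDefault) (by isBoundedDefault)
  let gr : E → ℝ := fun x => (Gsup x).toReal
  have hgr : ∀ x, Gsup x = (gr x : EReal) := fun x => by
    obtain ⟨n, hn⟩ := exists_nat_ge ‖x‖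
    refine (EReal.coe_toReal ?_ ?_).symm
    · exact ((hGLr x).trans_lt (EReal.coe_lt_top _)).ne
    · exact ((EReal.bot_lt_coe _).trans_le ((hAG n x hn).trans (hGGL x))).ne'
  have hAgr : ∀ (n : ℕ) x, ‖x‖ ≤ n → A n x ≤ gr x := fun n x hn => by
    have := (hAG n x hn).trans (hGGL x)
    rw [hgr] at this
    exact_mod_cast this
  have hgrr : ∀ x, gr x ≤ r / κ x := fun x => by
    have := hGLr x
    rw [hgr] at this
    exact_mod_cast this
  have hgrusc : UpperSemicontinuous gr := by
    intro x c hc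
    obtain ⟨c', hc1, hc2⟩ := exists_between hc
    have h1 : Gsup x < (c' : EReal) := by rw [hgr]; exact_mod_cast hc1
    filter_upwards [eventually_eventually_nhds.2 (eventually_lt_of_limsup_lt h1)] with y hy
    have h2 : Gsup y ≤ (c' : EReal) :=
      limsup_le_of_le (by isBoundedDefault) (hy.mono fun z hz => hz.le)
    rw [hgr] at h2
    exact lt_of_le_of_lt (by exact_mod_cast h2) hc2
  -- approximating points
  have happ : ∀ x, ∀ ε > (0 : ℝ), ∃ y, dist y x < ε ∧ ∃ n : ℕ, ‖y‖ ≤ n ∧ gr x - ε < A n y := by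
    intro x ε hε
    have h1 : ((gr x - ε : ℝ) : EReal) < Gsup x := by
      rw [hgr]; exact EReal.coe_lt_coe_iff.2 (by linarith)
    have h2 := frequently_lt_of_lt_limsup (by isBoundedDefault) h1
    obtain ⟨y, hy1, hy2⟩ := (h2.and_eventually (Metric.ball_mem_nhds x hε)).exists
    obtain ⟨n, hn⟩ := lt_iSup_iff.1 hy1
    obtain ⟨hn1, hn2⟩ := lt_iSup_iff.1 hn
    exact ⟨y, hy2, n, hn1, by exact_mod_cast hn2⟩
  refine ⟨fun x => (gr x : EReal), ?_, ?_⟩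
  · intro h hh0 hh x
    have hsup : ∀ u : ℕ → E, Tendsto u atTop (𝓝 x) →
        limsup (fun n => diffQuot S f (h n) (u n)) atTop ≤ (gr x : EReal) := by
      intro u hu
      apply le_of_forall_gt_imp_ge_of_dense
      intro c hc
      obtain ⟨c1, hc1, hc1'⟩ := EReal.lt_iff_exists_real_btwn.1 hc
      have hc1 := EReal.coe_lt_coe_iff.1 hc1
      obtain ⟨ε, hε, hcε⟩ : ∃ ε > 0, c1 = gr x + 2 * ε := ⟨(c1 - gr x) / 2, by linarith, by ring⟩
      obtain ⟨m, hm⟩ := exists_nat_gt ‖x‖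
      let v : E → ℝ := fun y => if (m : ℝ) ≤ ‖y‖ then r / κ y else gr y
      have hv : RUk κ v := by
        refine ⟨usc_ite hgrusc hrκ hgrr m, r, fun y => ?_⟩
        rw [← le_div_iff₀ (hκ y)]
        simp only [v]
        split_ifs
        · exact le_rfl
        · exact hgrr y
      have hF : RUk κ (fun y => 2 * f y + 2 * v y) :=
        (hf.ruk hκ).comb hv (by norm_num) (by norm_num)
      have hvx : v x = gr x := by simp only [v, not_le.2 hm, if_false]
      obtain ⟨δ1, hδ1, hn1⟩ := S_near hS le_rfl (hF.mem hκ) (x := x)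
        (c := ((2 * (f x + gr x + ε) : ℝ) : EReal)) (by
          rw [hS.idZero _ (hF.mem hκ)]
          apply EReal.coe_lt_coe_iff.2
          change 2 * f x + 2 * v x < _
          rw [hvx]
          linarith)
      have hneg : RUk κ (fun y => - fn m y) := by
        refine ⟨(hfnC m).1.neg.upperSemicontinuous, 0, fun y => ?_⟩
        nlinarith [mul_nonneg (h0 m y) (hκ y).le]
      obtain ⟨δ2, hδ2, hn2⟩ := S_near hS le_rfl (hneg.mem hκ) (x := x)
        (c := ((- f x + ε : ℝ) : EReal)) (by
          rw [hS.idZero _ (hneg.mem hκ)]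
          apply EReal.coe_lt_coe_iff.2
          change - fn m x < _
          rw [heq m x hm.le]
          linarith)
      obtain ⟨M, hMm⟩ := hM m
      have main : ∀ t, 0 < t → t < δ1 → t < δ2 → ∀ y, dist y x < δ1 → dist y x < δ2 →
          (S t (ecoe f) y).toReal ≤ f y + t * (gr x + 2 * ε) := by
        intro t ht ht1 ht2 y hy1 hy2
        apply le_of_forall_pos_le_add
        intro η hη
        obtain ⟨n0, hn0⟩ := S_cont hκc hκ hκb hS hfc (fun n => (hfnC n).1) hR hfnR hle
          (fun k ε hε => ⟨k, fun n hn x hx => by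
            rw [heq n x (hx.trans (by exact_mod_cast hn)), sub_self]
            exact hε.le⟩) ht.le (isCompact_singleton (x := y)) hη
        obtain ⟨k, hk⟩ := exists_nat_ge ‖y‖
        obtain ⟨n, hn1', hn2', hn3', hn4'⟩ : ∃ n : ℕ, n0 ≤ n ∧ k ≤ n ∧ m ≤ n ∧ M ≤ n :=
          ⟨n0 + k + m + M, by omega, by omega, by omega, by omega⟩
        have a1 := hn0 n hn1' y rfl
        have a2 : fn n y = f y := heq n y (hk.trans (by exact_mod_cast hn2'))
        have a3 := key_est hκc hκ hκb hS (hfn n) (hA n) (hD n) ht (x := y) (a := f x + gr x + ε)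
          (b := f x - ε) (fun s hs hst => by
            have b1 := hS.monotone s hs _ _ (RUk.mem hκ
              (((hfnC n).ruk hκ).comb ((hA n).ruk hκ) (a := 2) (b := 2) (by norm_num)
                (by norm_num))) (hF.mem hκ)
              (fun z => by
                apply EReal.coe_le_coe_iff.2
                have c1 := hle n z
                have c2 : A n z ≤ v z := by
                  simp only [v]
                  split_ifs with hz
                  · exact hAr n z
                  · exact hAgr n z ((not_le.1 hz).le.trans (by exact_mod_cast hn3'))
                linarith) y
            refine b1.trans (hn1 s hs ?_ y hy1).le
            rw [sub_zero, abs_of_nonneg hs]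
            linarith)
          (fun s hs hst => by
            have b1 := hn2 s hs (by rw [sub_zero, abs_of_nonneg hs]; linarith) y hy2
            have b2 := conv_le hκ hS hs (F := fun _ => 0) (x := y)
              ⟨continuous_const.upperSemicontinuous, 0, by simp⟩ ((hfnC m).ruk hκ) hneg
              (lam := 1 / 2) (by norm_num) (by norm_num) (fun z => le_of_eq (by ring))
              (S_real hκ hS hs (hfnC m) y).le b1.le
            have b3 : S s (ecoe fun _ => 0) y = 0 := hS.zero s hs y
            rw [b3] at b2
            have b4 : (0 : ℝ) ≤ _ := EReal.coe_le_coe_iff.1 b2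
            have b5 := S_mono hκ hS hs (hfnC m) (hfnC n) (hMm n hn4') y
            linarith)
        rw [a2] at a3
        linarith
      apply limsup_le_of_le (by isBoundedDefault)
      filter_upwards [hh.eventually (gt_mem_nhds hδ1), hh.eventually (gt_mem_nhds hδ2),
        hu.eventually (Metric.ball_mem_nhds x hδ1), hu.eventually (Metric.ball_mem_nhds x hδ2)]
        with n a1 a2 a3 a4
      refine le_trans ?_ hc1'.le
      rw [dq_real hκ hS (hh0 n).le hf]
      apply EReal.coe_le_coe_iff.2
      have := main (h n) (hh0 n) a1 a2 (u n) a3 a4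
      rw [inv_mul_le_iff₀ (hh0 n), hcε]
      linarith
    refine ⟨hsup, ?_⟩
    obtain ⟨u, hu, hul⟩ := recovery (F := fun n => diffQuot S f (h n)) (L := gr x) (x := x) (by
      intro ε hε
      obtain ⟨y, hy, n, hn, hAn⟩ := happ x ε hε
      refine ⟨y, hy, ?_⟩
      obtain ⟨t0, ht0, H⟩ := (hD n).2 {y} isCompact_singleton (A n y - (gr x - ε)) (by linarith)
      filter_upwards [hh.eventually (gt_mem_nhds ht0)] with k hk
      rw [dq_real hκ hS (hh0 k).le hf]
      apply EReal.coe_le_coe_iff.2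
      have a1 := (abs_le.1 (H (h k) (hh0 k) hk.le y rfl)).1
      have a2 := S_mono hκ hS (hh0 k).le (hfnC n) hf (hle n) y
      rw [heq n _ hn] at a1
      have a3 : (h k)⁻¹ * ((S (h k) (ecoe (fn n)) y).toReal - f y) ≤
          (h k)⁻¹ * ((S (h k) (ecoe f) y).toReal - f y) := by
        apply mul_le_mul_of_nonneg_left _ (by have := hh0 k; positivity)
        linarith
      linarith)
    exact ⟨u, hu, tendsto_of_le_liminf_of_limsup_le hul (hsup u hu)⟩
  · intro x
    have hsup : ∀ u : ℕ → E, Tendsto u atTop (𝓝 x) →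
        limsup (fun n => ecoe (A n) (u n)) atTop ≤ (gr x : EReal) := by
      intro u hu
      apply le_of_forall_gt_imp_ge_of_dense
      intro c hc
      rw [← hgr] at hc
      apply limsup_le_of_le (by isBoundedDefault)
      filter_upwards [hu.norm.eventually (gt_mem_nhds (lt_add_one ‖x‖)),
        tendsto_natCast_atTop_atTop.eventually_ge_atTop (‖x‖ + 1),
        hu.eventually (eventually_lt_of_limsup_lt hc)] with n h1 h2 h3
      exact (hAG n (u n) (h1.le.trans h2)).trans h3.le
    refine ⟨hsup, ?_⟩
    obtain ⟨u, hu, hul⟩ := recovery (F := fun n => ecoe (A n)) (L := gr x) (x := x) (by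
      intro ε hε
      obtain ⟨y, hy, n, hn, hAn⟩ := happ x ε hε
      refine ⟨y, hy, ?_⟩
      obtain ⟨M, hMn⟩ := hM n
      filter_upwards [eventually_ge_atTop M, eventually_ge_atTop n] with k hk hkn
      apply EReal.coe_le_coe_iff.2
      have := deriv_mono hκ hS (hfnC n) (hfnC k) (hMn k hk) (hD n) (hD k) (y := y)
        (by rw [heq n y hn, heq k y (hn.trans (by exact_mod_cast hkn))])
      linarith)
    exact ⟨u, hu, tendsto_of_le_liminf_of_limsup_le hul (hsup u hu)⟩

end Helpers

/-- truncation approximation of the `Γ`-generator on `ℝ^d`. -/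
theorem stmt18 (d : ℕ)
    (κ : EuclideanSpace ℝ (Fin d) → ℝ)
    (hκc : Continuous κ) (hκpos : ∀ x, 0 < κ x) (hκbd : ∃ C, ∀ x, κ x ≤ C)
    (S : ℝ → (EuclideanSpace ℝ (Fin d) → EReal) → (EuclideanSpace ℝ (Fin d) → EReal))
    (hS : AssumptionS κ S)
    -- `C_c^∞ ⊂ D(A)`
    (hCc : ∀ ψ : EuclideanSpace ℝ (Fin d) → ℝ, ContDiff ℝ (⊤ : ℕ∞) ψ → HasCompactSupport ψ →
      UpperLip κ S ψ ∧ ∃ gψ, MemCk κ gψ ∧ MixedDeriv κ S ψ gψ)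
    (φn : ℕ → EuclideanSpace ℝ (Fin d) → ℝ)
    (hφsm : ∀ n, ContDiff ℝ (⊤ : ℕ∞) (φn n)) (hφcs : ∀ n, HasCompactSupport (φn n))
    (hφ01 : ∀ n x, 0 ≤ φn n x ∧ φn n x ≤ 1)
    (hφ1 : ∀ (n : ℕ) (x : EuclideanSpace ℝ (Fin d)), ‖x‖ ≤ (n : ℝ) → φn n x = 1)
    (f : EuclideanSpace ℝ (Fin d) → ℝ)
    (hfC : MemCk κ f) (hfsm : ContDiff ℝ (⊤ : ℕ∞) f) (hfpos : ∀ x, 0 ≤ f x)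
    (Af : ℕ → EuclideanSpace ℝ (Fin d) → ℝ)
    (hAfC : ∀ n, MemCk κ (Af n))
    (hAf : ∀ n, MixedDeriv κ S (fun x => f x * φn n x) (Af n)) :
    -- (i)
    (UpperLip κ S f →
      ∀ x, gammaLimsup (fun n => ecoe (Af n)) x ≤ uppGen S f x) ∧
    -- (ii)
    ((∃ r : ℝ, ∀ n x, max (Af n x) 0 * κ x ≤ r) →
      UpperLip κ S f ∧
        ∃ gf : EuclideanSpace ℝ (Fin d) → EReal,
          IsGammaDeriv S f gf ∧ IsGammaLim (fun n => ecoe (Af n)) gf) := by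
  have hsm : ∀ n, ContDiff ℝ (⊤ : ℕ∞) (fun x => f x * φn n x) := fun n => hfsm.mul (hφsm n)
  have hcs : ∀ n, HasCompactSupport (fun x => f x * φn n x) := fun n => (hφcs n).mul_left
  have hUL : ∀ n, UpperLip κ S (fun x => f x * φn n x) := fun n => (hCc _ (hsm n) (hcs n)).1
  have h0 : ∀ n x, 0 ≤ f x * φn n x := fun n x => mul_nonneg (hfpos x) (hφ01 n x).1
  have hle : ∀ n x, f x * φn n x ≤ f x := fun n x =>
    mul_le_of_le_one_right (hfpos x) (hφ01 n x).2
  have heq : ∀ (n : ℕ) x, ‖x‖ ≤ n → f x * φn n x = f x := fun n x hx => by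
    rw [hφ1 n x hx, mul_one]
  have hM : ∀ n, ∃ M : ℕ, ∀ p, M ≤ p → ∀ x, f x * φn n x ≤ f x * φn p x := by
    intro n
    obtain ⟨R, hR⟩ := (hφcs n).isCompact.isBounded.exists_norm_le
    obtain ⟨M, hM⟩ := exists_nat_ge R
    refine ⟨M, fun p hp x => ?_⟩
    by_cases hx : x ∈ tsupport (φn n)
    · rw [heq p x (((hR x hx).trans hM).trans (by exact_mod_cast hp))]
      exact hle n x
    · rw [image_eq_zero_of_notMem_tsupport hx, mul_zero]
      exact h0 p x
  refine ⟨fun _ x => ?_, ?_⟩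
  · exact part_one hκpos hS (fn := fun n x => f x * φn n x) hfC (fun n => (hUL n).1) hle heq hAf x
  · rintro ⟨r, hr⟩
    exact ⟨upperLip_of_bdd hκc hκpos hκbd hS (fn := fun n x => f x * φn n x) hfC hUL h0 hle heq
        hAfC hAf hr,
      part_two hκc hκpos hκbd hS (fn := fun n x => f x * φn n x) hfC hUL h0 hle heq hM
        hAfC hAf hr⟩
end
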